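/- There exists a set D ⊆ ℕ with D ≤_T ∅'' such that: (a) for every ∅'-computable martingale M there is an infinite Δ⁰₂ set A on which M does not succeed and which has an infinite subset computable in D (so the class of Δ⁰₂ sets with an infinite subset or cosubset computable in D is not Δ⁰₂ null); and (b) there exists a Δ⁰₂ set having no infinite subset and no infinite cosubset computable in D. Hence there is a Δ⁰₃ almost s-Ramsey degree that is not s-Ramsey. -/

import Mathlib

/-!
Preamble: oracle computability, Turing reducibility, the jump, martingales,
and Martin-Löf randomness, developed from scratch.
-/

open scoped Classical

/-- The characteristic function of a set of naturals. -/
noncomputable def chi (A : Set ℕ) : ℕ → ℕ :=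
  fun n => if n ∈ A then 1 else 0

/-- Partial functions recursive in a (total) oracle `O : ℕ → ℕ`.
This mirrors `Nat.Partrec`, with an additional constructor for the oracle. -/
inductive RecIn (O : ℕ → ℕ) : (ℕ →. ℕ) → Prop
  | oracle : RecIn O (fun n => Part.some (O n))
  | zero : RecIn O (fun _ => Part.some 0)
  | succ : RecIn O (fun n => Part.some (n + 1))
  | left : RecIn O (fun n => Part.some (Nat.unpair n).1)
  | right : RecIn O (fun n => Part.some (Nat.unpair n).2)
  | pair {f g} : RecIn O f → RecIn O g → RecIn O (fun n => Nat.pair <$> f n <*> g n)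
  | comp {f g} : RecIn O f → RecIn O g → RecIn O (fun n => g n >>= f)
  | prec {f g} :
      RecIn O f → RecIn O g →
      RecIn O
        (Nat.unpaired fun a n =>
          n.rec (f a) fun y IH => do
            let i ← IH
            g (Nat.pair a (Nat.pair y i)))
  | rfind {f} :
      RecIn O f →
      RecIn O (fun a => Nat.rfind fun n => (fun m => m = 0) <$> f (Nat.pair a n))

/-- Codes for oracle machines. -/
inductive OCode : Type
  | zero : OCode
  | succ : OCode
  | left : OCode
  | right : OCode
  | oracle : OCode
  | pair : OCode → OCode → OCode
  | comp : OCode → OCode → OCode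
  | prec : OCode → OCode → OCode
  | rfind' : OCode → OCode

/-- Evaluation of oracle codes relative to a total oracle. -/
def evalo (O : ℕ → ℕ) : OCode → ℕ →. ℕ
  | .zero => fun _ => Part.some 0
  | .succ => fun n => Part.some (n + 1)
  | .left => fun n => Part.some (Nat.unpair n).1
  | .right => fun n => Part.some (Nat.unpair n).2
  | .oracle => fun n => Part.some (O n)
  | .pair cf cg => fun n => Nat.pair <$> evalo O cf n <*> evalo O cg n
  | .comp cf cg => fun n => evalo O cg n >>= evalo O cf
  | .prec cf cg =>
      Nat.unpaired fun a n =>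
        n.rec (evalo O cf a) fun y IH => do
          let i ← IH
          evalo O cg (Nat.pair a (Nat.pair y i))
  | .rfind' cf =>
      Nat.unpaired fun a m =>
        (Nat.rfind fun n => (fun x => x = 0) <$> evalo O cf (Nat.pair a (n + m))).map (· + m)

/-- A surjective listing of oracle codes. -/
def ofNatOCode : ℕ → OCode
  | 0 => .zero
  | 1 => .succ
  | 2 => .left
  | 3 => .right
  | 4 => .oracle
  | n + 5 =>
    have hm : n.div2.div2 < n + 5 := by
      rw [Nat.div2_val, Nat.div2_val]
      exact lt_of_le_of_lt (le_trans (Nat.div_le_self _ _) (Nat.div_le_self _ _))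
        (Nat.lt_succ_of_le (Nat.le_add_right _ 4))
    have _m1 : n.div2.div2.unpair.1 < n + 5 :=
      lt_of_le_of_lt (Nat.unpair_left_le _) hm
    have _m2 : n.div2.div2.unpair.2 < n + 5 :=
      lt_of_le_of_lt (Nat.unpair_right_le _) hm
    match n.bodd, n.div2.bodd with
    | false, false => .pair (ofNatOCode n.div2.div2.unpair.1) (ofNatOCode n.div2.div2.unpair.2)
    | false, true  => .comp (ofNatOCode n.div2.div2.unpair.1) (ofNatOCode n.div2.div2.unpair.2)
    | true , false => .prec (ofNatOCode n.div2.div2.unpair.1) (ofNatOCode n.div2.div2.unpair.2)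
    | true , true  => .rfind' (ofNatOCode n.div2.div2)

/-- `Phi O e` is the `e`-th partial `O`-computable function `Φ_e^O`. -/
def Phi (O : ℕ → ℕ) (e : ℕ) : ℕ →. ℕ := evalo O (ofNatOCode e)

/-- The Turing jump `A'` of a set `A`. -/
noncomputable def jump (A : Set ℕ) : Set ℕ := {e | (Phi (chi A) e e).Dom}

/-- The halting set `∅'`. -/
noncomputable def K : Set ℕ := jump ∅

/-- Turing reducibility between sets: `TRed B A` means `B ≤_T A`. -/
noncomputable def TRed (B A : Set ℕ) : Prop :=
  RecIn (chi A) (fun n => Part.some (chi B n))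

/-- The effective join of two sets. -/
def join (A B : Set ℕ) : Set ℕ :=
  {n | (∃ a ∈ A, n = 2 * a) ∨ (∃ b ∈ B, n = 2 * b + 1)}

/-- A set is low if its jump is Turing reducible to `∅'`. -/
noncomputable def Low (L : Set ℕ) : Prop := TRed (jump L) K

/-- The function `f : α → β` presented as an oracle on `ℕ`, via the encodings. -/
def fnOracle {α β : Type} [Encodable α] [Encodable β] (f : α → β) : ℕ → ℕ :=
  fun n => Encodable.encode ((Encodable.decode (α := α) n).map f)

/-- `FRed f A` means the function `f` is Turing reducible to the set `A`. -/
noncomputable def FRed {α β : Type} [Encodable α] [Encodable β] (f : α → β) (A : Set ℕ) : Prop :=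
  RecIn (chi A) (fun n => Part.some (fnOracle f n))

/-- `FFRed g f` means the function `g` is Turing reducible to the function `f`. -/
def FFRed {α β γ δ : Type} [Encodable α] [Encodable β] [Encodable γ] [Encodable δ]
    (g : γ → δ) (f : α → β) : Prop :=
  RecIn (fnOracle f) (fun n => Part.some (fnOracle g n))

/-- A martingale: a nonnegative rational-valued function on finite binary strings
satisfying the averaging condition `2 M(σ) = M(σ0) + M(σ1)`. -/
def IsMartingale (M : List Bool → ℚ) : Prop :=
  (∀ σ, 0 ≤ M σ) ∧ ∀ σ, 2 * M σ = M (σ ++ [false]) + M (σ ++ [true])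

/-- The length-`n` initial segment of the characteristic sequence of `A`. -/
noncomputable def seg (A : Set ℕ) (n : ℕ) : List Bool :=
  (List.range n).map fun i => if i ∈ A then true else false

/-- A martingale succeeds on a set `A` if `limsup_n M(A↾n) = ∞`. -/
noncomputable def Succeeds (M : List Bool → ℚ) (A : Set ℕ) : Prop :=
  ∀ q : ℚ, ∃ n, q < M (seg A n)

/-- `H(A)`: the mass problem of infinite subsets or cosubsets of `A`. -/
def Hset (A : Set ℕ) : Set (Set ℕ) :=
  {S | S.Infinite ∧ (S ⊆ A ∨ S ⊆ Aᶜ)}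

/-- Muchnik reducibility: `MuchnikLe P Q` iff every member of `Q` computes a member of `P`. -/
noncomputable def MuchnikLe (P Q : Set (Set ℕ)) : Prop :=
  ∀ B ∈ Q, ∃ A ∈ P, TRed A B

/-- A set of naturals is computably enumerable. -/
def CE (W : Set ℕ) : Prop :=
  ∃ g : ℕ →. ℕ, RecIn (fun _ => 0) g ∧ ∀ n, n ∈ W ↔ (g n).Dom

/-- A Martin-Löf test: a uniformly c.e. sequence of sets of strings `U n`,
with the open set generated by `U n` having measure at most `2^{-n}`. -/
def MLTest (U : ℕ → Set (List Bool)) : Prop :=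
  CE {p : ℕ | ∃ σ ∈ U (Nat.unpair p).1, (Nat.unpair p).2 = Encodable.encode σ} ∧
  ∀ n, (∑' σ : (U n), ((1 : ENNReal) / 2) ^ (σ : List Bool).length) ≤ (1 / 2) ^ n

/-- A set is 1-random (Martin-Löf random) if for every Martin-Löf test there is
an `n` such that no initial segment of the set lies in `U n`. -/
noncomputable def MLRandom (A : Set ℕ) : Prop :=
  ∀ U : ℕ → Set (List Bool), MLTest U → ∃ n, ∀ m, seg A m ∉ U n

open Encodable


theorem seg_length (A : Set ℕ) (m : ℕ) : (seg A m).length = m := by simp [seg]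

theorem seg_get (A : Set ℕ) (m i : ℕ) (h : i < m) :
    (seg A m)[i]? = some (decide (i ∈ A)) := by
  simp [seg, h]

theorem seg_get_none (A : Set ℕ) (m i : ℕ) (h : m ≤ i) :
    (seg A m)[i]? = none := by
  simp [seg, h]

theorem seg_succ (A : Set ℕ) (m : ℕ) : seg A (m+1) = seg A m ++ [decide (m ∈ A)] := by
  simp [seg, List.range_succ]

theorem comp2 {α β σ : Type} [Primcodable α] [Primcodable β] [Primcodable σ]
    {f : α → β → σ} (h : Computable (fun p : α × β => f p.1 p.2)) : Computable₂ f := h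

/-- partial functions computable relative to `A`, via finite initial segments -/
def PR (A : Set ℕ) {α β : Type} [Primcodable α] [Primcodable β] (f : α → Part β) : Prop :=
  ∃ F : List Bool × α → Option β, Computable F ∧
    (∀ m a b, F (seg A m, a) = some b → b ∈ f a) ∧
    ∀ a b, b ∈ f a → ∃ m0, ∀ m ≥ m0, F (seg A m, a) = some b

def CI (A : Set ℕ) {α β : Type} [Primcodable α] [Primcodable β] (f : α → β) : Prop :=
  PR A (fun a => Part.some (f a))

section
variable {A : Set ℕ} {α β γ : Type} [Primcodable α] [Primcodable β] [Primcodable γ]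

theorem PR.of_eq {f g : α → Part β} (hf : PR A f) (h : ∀ a, f a = g a) : PR A g := by
  have : f = g := funext h
  exact this ▸ hf

theorem CI.of_eq {f g : α → β} (hf : CI A f) (h : ∀ a, f a = g a) : CI A g := by
  have : f = g := funext h
  exact this ▸ hf

theorem CI.of_computable {f : α → β} (hf : Computable f) : CI A f :=
  ⟨fun p => some (f p.2), Computable.option_some.comp (hf.comp Computable.snd),
    by intro m a b h; simpa using h.symm,
    by intro a b h; exact ⟨0, fun m _ => by simpa using (Part.mem_some_iff.1 h).symm⟩⟩

theorem CI.of_primrec {f : α → β} (hf : Primrec f) : CI A f := CI.of_computable hf.to_comp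

theorem PR.bind {f : α → Part β} {g : α → β → Part γ} (hf : PR A f)
    (hg : PR A (fun p : α × β => g p.1 p.2)) : PR A (fun a => (f a).bind (g a)) := by
  obtain ⟨F, cF, sF, eF⟩ := hf
  obtain ⟨G, cG, sG, eG⟩ := hg
  refine ⟨fun p => (F p).bind (fun b => G (p.1, (p.2, b))), ?_, ?_, ?_⟩
  · refine Computable.option_bind cF (comp2 ?_)
    exact cG.comp (Computable.pair (Computable.fst.comp Computable.fst)
      (Computable.pair (Computable.snd.comp Computable.fst) Computable.snd))
  · intro m a c h
    simp only [Option.bind_eq_some_iff] at h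
    obtain ⟨b, hb, hc⟩ := h
    exact Part.mem_bind (sF _ _ _ hb) (sG _ _ _ hc)
  · intro a c h
    obtain ⟨b, hb, hc⟩ := Part.mem_bind_iff.1 h
    obtain ⟨m0, h0⟩ := eF _ _ hb
    obtain ⟨m1, h1⟩ := eG (a, b) _ hc
    refine ⟨max m0 m1, fun m hm => ?_⟩
    simp only [h0 m (le_trans (le_max_left _ _) hm), Option.bind_some]
    exact h1 m (le_trans (le_max_right _ _) hm)

theorem PR.comp {g : β → Part γ} {f : α → β} (hg : PR A g) (hf : CI A f) :
    PR A (fun a => g (f a)) := by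
  obtain ⟨F, cF, sF, eF⟩ := hf
  obtain ⟨G, cG, sG, eG⟩ := hg
  refine ⟨fun p => (F p).bind (fun b => G (p.1, b)), ?_, ?_, ?_⟩
  · refine Computable.option_bind cF (comp2 ?_)
    exact cG.comp (Computable.pair (Computable.fst.comp Computable.fst) Computable.snd)
  · intro m a c h
    simp only [Option.bind_eq_some_iff] at h
    obtain ⟨b, hb, hc⟩ := h
    have := sF _ _ _ hb
    simp only [Part.mem_some_iff] at this
    show c ∈ g (f a)
    exact this ▸ (sG _ _ _ hc)
  · intro a c h
    obtain ⟨m0, h0⟩ := eF a _ (Part.mem_some _)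
    obtain ⟨m1, h1⟩ := eG (f a) _ h
    refine ⟨max m0 m1, fun m hm => ?_⟩
    simp only [h0 m (le_trans (le_max_left _ _) hm), Option.bind_some]
    exact h1 m (le_trans (le_max_right _ _) hm)

theorem CI.comp {g : β → γ} {f : α → β} (hg : CI A g) (hf : CI A f) :
    CI A (fun a => g (f a)) := PR.comp (g := fun b => Part.some (g b)) hg hf

theorem CI.pair {f : α → β} {g : α → γ} (hf : CI A f) (hg : CI A g) :
    CI A (fun a => (f a, g a)) := by
  have h1 : CI A (fun p : α × β => (p.2, g p.1)) := by
    have h2 : CI A (fun p : (α × β) => g p.1) := hg.comp (CI.of_computable Computable.fst)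
    have h3 := PR.bind (g := fun (p : α × β) (c : γ) => Part.some (p.2, c)) h2
      (CI.of_computable (A := A) (f := fun q : (α × β) × γ => (q.1.2, q.2))
        (Computable.pair (Computable.snd.comp Computable.fst) Computable.snd))
    exact h3.of_eq (by intro a; simp)
  exact (PR.bind (g := fun a b => Part.some (b, g a)) hf h1).of_eq (by intro a; simp)

theorem PR.cond {c : α → Bool} {f g : α → Part β} (hc : CI A c) (hf : PR A f) (hg : PR A g) :
    PR A (fun a => bif c a then f a else g a) := by
  obtain ⟨C, cC, sC, eC⟩ := hc
  obtain ⟨F, cF, sF, eF⟩ := hf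
  obtain ⟨G, cG, sG, eG⟩ := hg
  refine ⟨fun p => (C p).bind (fun b => bif b then F p else G p), ?_, ?_, ?_⟩
  · refine Computable.option_bind cC (comp2 ?_)
    exact Computable.cond Computable.snd (cF.comp Computable.fst) (cG.comp Computable.fst)
  · intro m a c' h
    simp only [Option.bind_eq_some_iff] at h
    obtain ⟨b, hb, hc⟩ := h
    have := sC _ _ _ hb
    simp only [Part.mem_some_iff] at this
    show c' ∈ (bif c a then f a else g a)
    rw [← this]
    cases b
    · exact sG _ _ _ hc
    · exact sF _ _ _ hc
  · intro a c' h
    change c' ∈ (bif c a then f a else g a) at h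
    obtain ⟨m0, h0⟩ := eC a _ (Part.mem_some _)
    cases hca : c a
    · rw [hca] at h h0
      obtain ⟨m1, h1⟩ := eG a _ h
      refine ⟨max m0 m1, fun m hm => ?_⟩
      simp only [h0 m (le_trans (le_max_left _ _) hm), Option.bind_some]
      exact h1 m (le_trans (le_max_right _ _) hm)
    · rw [hca] at h h0
      obtain ⟨m1, h1⟩ := eF a _ h
      refine ⟨max m0 m1, fun m hm => ?_⟩
      simp only [h0 m (le_trans (le_max_left _ _) hm), Option.bind_some]
      exact h1 m (le_trans (le_max_right _ _) hm)

theorem CI.cond {c : α → Bool} {f g : α → β} (hc : CI A c) (hf : CI A f) (hg : CI A g) :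
    CI A (fun a => bif c a then f a else g a) :=
  (PR.cond hc hf hg).of_eq (by intro a; cases h : c a <;> simp [h])

theorem CI.oracle : CI A (fun n => decide (n ∈ A)) := by
  refine ⟨fun p => p.1[p.2]?, Computable.list_getElem?.comp Computable.fst Computable.snd, ?_, ?_⟩
  · intro m a b h
    change (_root_.seg A m)[a]? = _ at h
    by_cases hm : a < m
    · rw [seg_get _ _ _ hm] at h; simpa using h.symm
    · rw [seg_get_none _ _ _ (not_lt.1 hm)] at h; simp at h
  · intro a b h
    refine ⟨a+1, fun m hm => ?_⟩
    change (_root_.seg A m)[a]? = _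
    rw [seg_get _ _ _ hm]; simpa using (Part.mem_some_iff.1 h).symm

theorem PR.nat_rec {f : α → Part β} {g : α × ℕ × β → Part β} (hf : PR A f) (hg : PR A g) :
    PR A (fun p : α × ℕ => (p.2.rec (f p.1) (fun y IH => IH.bind (fun i => g (p.1, y, i))) :
      Part β)) := by
  obtain ⟨F, cF, sF, eF⟩ := hf
  obtain ⟨G, cG, sG, eG⟩ := hg
  refine ⟨fun p => (p.2.2.rec (F (p.1, p.2.1))
    (fun y IH => IH.bind (fun i => G (p.1, (p.2.1, y, i)))) : Option β), ?_, ?_, ?_⟩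
  · refine Computable.nat_rec (f := fun p : List Bool × α × ℕ => p.2.2)
      (g := fun p => F (p.1, p.2.1))
      (h := fun p q => q.2.bind (fun i => G (p.1, (p.2.1, q.1, i))))
      (Computable.snd.comp Computable.snd) ?_ (comp2 ?_)
    · exact cF.comp (Computable.pair Computable.fst (Computable.fst.comp Computable.snd))
    · refine Computable.option_bind (Computable.snd.comp Computable.snd) (comp2 ?_)
      refine cG.comp (Computable.pair ?_ (Computable.pair ?_ (Computable.pair ?_ ?_)))
      · exact Computable.fst.comp (Computable.fst.comp Computable.fst)
      · exact Computable.fst.comp (Computable.snd.comp (Computable.fst.comp Computable.fst))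
      · exact Computable.fst.comp (Computable.snd.comp Computable.fst)
      · exact Computable.snd
  · rintro m ⟨a, n⟩ 
    dsimp only
    induction n with
    | zero => intro b h; exact sF _ _ _ h
    | succ n ih =>
      intro b h
      simp only [Option.bind_eq_some_iff] at h
      obtain ⟨i, hi, h2⟩ := h
      exact Part.mem_bind (ih _ hi) (sG _ _ _ h2)
  · rintro ⟨a, n⟩ 
    dsimp only
    induction n with
    | zero => intro b h; exact eF _ _ h
    | succ n ih =>
      intro c h
      obtain ⟨b, hb, hc⟩ := Part.mem_bind_iff.1 h
      obtain ⟨m0, h0⟩ := ih _ hb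
      obtain ⟨m1, h1⟩ := eG _ _ hc
      refine ⟨max m0 m1, fun m hm => ?_⟩
      simp only [h0 m (le_trans (le_max_left _ _) hm), Option.bind_some]
      exact h1 m (le_trans (le_max_right _ _) hm)

theorem CI.nat_rec {f : α → β} {g : α × ℕ × β → β} (hf : CI A f) (hg : CI A g) :
    CI A (fun p : α × ℕ => (p.2.rec (f p.1) (fun y i => g (p.1, y, i)) : β)) := by
  refine (PR.nat_rec hf hg).of_eq ?_
  rintro ⟨a, n⟩
  dsimp only
  induction n with
  | zero => rfl
  | succ n ih => simp only [ih, Part.bind_some]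

theorem PR.rfind {p : α × ℕ → Part Bool} (hp : PR A p) :
    PR A (fun a => Nat.rfind (fun n => p (a, n))) := by
  obtain ⟨F, cF, sF, eF⟩ := hp
  -- state: inl searching (some none), found some (some n), stuck none
  let st : List Bool × α → ℕ → Option (Option ℕ) := fun q n =>
    n.rec (some none) (fun y IH => IH.bind (fun i => Option.casesOn i
      ((F (q.1, (q.2, y))).bind (fun b => bif b then some (some y) else some none))
      (fun k => some (some k))))
  have cst : Computable (fun q : List Bool × α => st q q.1.length) := by
    refine Computable.nat_rec (f := fun q : List Bool × α => q.1.length)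
      (g := fun q => some none)
      (h := fun q r => r.2.bind (fun i => Option.casesOn i
      ((F (q.1, (q.2, r.1))).bind (fun b => bif b then some (some r.1) else some none))
      (fun k => some (some k)))) (Computable.list_length.comp Computable.fst)
      (Computable.const _) (comp2 ?_)
    refine Computable.option_bind (Computable.snd.comp Computable.snd) (comp2 ?_)
    refine Computable.option_casesOn Computable.snd ?_ (comp2 ?_)
    · refine Computable.option_bind ?_ (comp2 ?_)
      · refine cF.comp (Computable.pair ?_ (Computable.pair ?_ ?_))
        · exact Computable.fst.comp (Computable.fst.comp Computable.fst)
        · exact Computable.snd.comp (Computable.fst.comp Computable.fst)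
        · exact Computable.fst.comp (Computable.snd.comp Computable.fst)
      · refine Computable.cond Computable.snd ?_ (Computable.const _)
        refine Computable.option_some.comp (Computable.option_some.comp ?_)
        exact Computable.fst.comp (Computable.snd.comp (Computable.fst.comp Computable.fst))
    · exact Computable.option_some.comp (Computable.option_some.comp Computable.snd)
  have inv : ∀ m a n, (st (seg A m, a) n = some none → ∀ k < n, false ∈ p (a, k)) ∧
      (∀ j, st (seg A m, a) n = some (some j) → j ∈ Nat.rfind (fun n => p (a, n))) := by
    intro m a n
    induction n with
    | zero => exact ⟨fun _ k hk => absurd hk (Nat.not_lt_zero _), fun j h => by simp [st] at h⟩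
    | succ n ih =>
      have hs : st (seg A m, a) (n+1) = (st (seg A m, a) n).bind (fun i => Option.casesOn i
        ((F (seg A m, (a, n))).bind (fun b => bif b then some (some n) else some none))
        (fun k => some (some k))) := rfl
      rw [hs]
      rcases h : st (seg A m, a) n with _ | _ | j
      · simp
      · simp only [Option.bind_some]
        rcases hF : F (seg A m, (a, n)) with _ | _ | _
        · simp
        · simp only [Option.bind_some, cond_false]
          refine ⟨fun _ k hk => ?_, fun j h => by simp at h⟩
          rcases Nat.lt_succ_iff_lt_or_eq.1 hk with hk | rfl
          · exact ih.1 h k hk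
          · exact sF _ _ _ hF
        · simp only [Option.bind_some, cond_true]
          refine ⟨fun h => by simp at h, fun j hj => ?_⟩
          simp only [Option.some.injEq] at hj
          subst hj
          exact Nat.mem_rfind.2 ⟨sF _ _ _ hF, fun {k} hk => ih.1 h k hk⟩
      · simp only [Option.bind_some]
        refine ⟨fun h => by simp at h, fun j' hj => ?_⟩
        simp only [Option.some.injEq] at hj
        exact hj ▸ ih.2 _ h
  refine ⟨fun q => (st q q.1.length).bind id, Computable.option_bind cst Computable.snd.to₂, ?_, ?_⟩
  · intro m a b h
    simp only [Option.bind_eq_some_iff, id, seg_length] at h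
    obtain ⟨o, ho, rfl⟩ := h
    exact (inv m a m).2 b ho
  · intro a j hj
    obtain ⟨h1, h2⟩ := Nat.mem_rfind.1 hj
    have h3 : ∀ n ≤ j, ∃ m0, ∀ m ≥ m0, st (seg A m, a) n = some none := by
      intro n
      induction n with
      | zero => intro _; exact ⟨0, fun m _ => rfl⟩
      | succ n ih =>
        intro hn
        obtain ⟨m0, h0⟩ := ih (by omega)
        obtain ⟨m1, h1⟩ := eF _ _ (h2 (show n < j by omega))
        refine ⟨max m0 m1, fun m hm => ?_⟩
        have hs : st (seg A m, a) (n+1) = (st (seg A m, a) n).bind (fun i => Option.casesOn i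
          ((F (seg A m, (a, n))).bind (fun b => bif b then some (some n) else some none))
          (fun k => some (some k))) := rfl
        rw [hs, h0 m (le_trans (le_max_left _ _) hm)]
        simp only [Option.bind_some, h1 m (le_trans (le_max_right _ _) hm), cond_false]
    obtain ⟨m0, h0⟩ := h3 j le_rfl
    obtain ⟨m1, h1⟩ := eF _ _ h1
    have h4 : ∀ m ≥ max m0 m1, ∀ n ≥ j + 1, st (seg A m, a) n = some (some j) := by
      intro m hm n hn
      induction n, hn using Nat.le_induction with
      | base =>
        have hs : st (seg A m, a) (j+1) = (st (seg A m, a) j).bind (fun i => Option.casesOn i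
          ((F (seg A m, (a, j))).bind (fun b => bif b then some (some j) else some none))
          (fun k => some (some k))) := rfl
        rw [hs, h0 m (le_trans (le_max_left _ _) hm)]
        simp only [Option.bind_some, h1 m (le_trans (le_max_right _ _) hm), cond_true]
      | succ n hn ih =>
        have hs : st (seg A m, a) (n+1) = (st (seg A m, a) n).bind (fun i => Option.casesOn i
          ((F (seg A m, (a, n))).bind (fun b => bif b then some (some n) else some none))
          (fun k => some (some k))) := rfl
        rw [hs, ih]
        rfl
    refine ⟨max (max m0 m1) (j+1), fun m hm => ?_⟩
    simp only [seg_length]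
    rw [h4 m (le_trans (le_max_left _ _) hm) m (le_trans (le_max_right _ _) hm)]
    rfl

theorem CI_seg : CI A (fun m => seg A m) := by
  have h := CI.nat_rec (A := A) (α := Unit) (f := fun _ => ([] : List Bool))
    (g := fun q => q.2.2 ++ [decide (q.2.1 ∈ A)]) (CI.of_computable (Computable.const _)) ?_
  · refine (h.comp (CI.of_computable (f := fun m : ℕ => ((), m))
      (Computable.pair (Computable.const _) Computable.id))).of_eq ?_
    intro m
    dsimp only
    induction m with
    | zero => simp [_root_.seg]
    | succ m ih => rw [seg_succ, ← ih]
  · refine (CI.of_computable (A := A) (f := fun q : List Bool × Bool => q.1 ++ [q.2])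
      (Primrec.list_concat.comp Primrec.fst Primrec.snd).to_comp).comp (CI.pair ?_ ?_)
    · exact CI.of_computable (Computable.snd.comp Computable.snd)
    · exact CI.oracle.comp (CI.of_computable (Computable.fst.comp Computable.snd))

end

theorem PR.of_recIn {B : Set ℕ} {O : ℕ → ℕ} (hO : CI B O) {f : ℕ →. ℕ} (hf : RecIn O f) :
    PR B f := by
  induction hf with
  | oracle => exact hO
  | zero => exact CI.of_computable (Computable.const 0)
  | succ => exact CI.of_computable Computable.succ
  | left => exact CI.of_computable (Computable.fst.comp Computable.unpair)
  | right => exact CI.of_computable (Computable.snd.comp Computable.unpair)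
  | pair _ _ ihf ihg =>
    rename_i f g _ _
    have h2 : PR B (fun p : ℕ × ℕ => g p.1) := ihg.comp (CI.of_computable Computable.fst)
    have h3 : PR B (fun p : ℕ × ℕ => (g p.1).bind (fun b => Part.some (Nat.pair p.2 b))) := by
      refine PR.bind h2 (CI.of_computable (f := fun q : (ℕ × ℕ) × ℕ => Nat.pair q.1.2 q.2) ?_)
      exact (Primrec₂.natPair.comp (Primrec.snd.comp Primrec.fst) Primrec.snd).to_comp
    refine (PR.bind (g := fun a b => (g a).bind (fun c => Part.some (Nat.pair b c))) ihf h3).of_eq ?_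
    intro a
    simp [Seq.seq, Part.bind_some_eq_map]
  | comp _ _ ihf ihg =>
    exact PR.bind ihg (ihf.comp (CI.of_computable Computable.snd))
  | prec _ _ ihf ihg =>
    rename_i f g _ _
    have hg : PR B (fun q : ℕ × ℕ × ℕ => g (Nat.pair q.1 (Nat.pair q.2.1 q.2.2))) := by
      refine ihg.comp (CI.of_primrec ?_)
      exact Primrec₂.natPair.comp Primrec.fst (Primrec₂.natPair.comp
        (Primrec.fst.comp Primrec.snd) (Primrec.snd.comp Primrec.snd))
    exact (PR.nat_rec ihf hg).comp (CI.of_computable Computable.unpair)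
  | rfind _ ih =>
    rename_i f _
    have h1 : PR B (fun q : ℕ × ℕ => f (Nat.pair q.1 q.2)) :=
      ih.comp (CI.of_primrec (Primrec₂.natPair.comp Primrec.fst Primrec.snd))
    have h2 := PR.bind (g := fun _ b => Part.some (decide (b = 0))) h1
      (CI.of_primrec (f := fun q : (ℕ × ℕ) × ℕ => decide (q.2 = 0))
        (PrimrecPred.decide (Primrec.eq.comp Primrec.snd (Primrec.const 0))))
    refine (PR.rfind h2).of_eq ?_
    intro a
    simp [Part.bind_some_eq_map]

theorem CI_chi {A : Set ℕ} : CI A (chi A) := by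
  refine (CI.cond CI.oracle (CI.of_computable (Computable.const 1))
    (CI.of_computable (Computable.const 0))).of_eq ?_
  intro n
  simp only [_root_.chi]
  by_cases h : n ∈ A <;> simp [h]


theorem RecIn.of_partrec {O : ℕ → ℕ} {f : ℕ →. ℕ} (hf : Nat.Partrec f) : RecIn O f := by
  induction hf with
  | zero => exact RecIn.zero
  | succ => exact RecIn.succ
  | left => exact RecIn.left
  | right => exact RecIn.right
  | pair _ _ ihf ihg => exact RecIn.pair ihf ihg
  | comp _ _ ihf ihg => exact RecIn.comp ihf ihg
  | prec _ _ ihf ihg => exact RecIn.prec ihf ihg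
  | rfind _ ih => exact RecIn.rfind ih

def RT (O : ℕ → ℕ) (f : ℕ → ℕ) : Prop := RecIn O (fun n => Part.some (f n))

theorem RecIn.of_eq {O : ℕ → ℕ} {f g : ℕ →. ℕ} (hf : RecIn O f) (h : ∀ n, f n = g n) : RecIn O g := by
  have : f = g := funext h
  exact this ▸ hf

theorem RT.of_eq {O f g : ℕ → ℕ} (hf : RT O f) (h : ∀ n, f n = g n) : RT O g := by
  have : f = g := funext h
  exact this ▸ hf

theorem RT.of_computable {O f : ℕ → ℕ} (hf : Computable f) : RT O f :=
  RecIn.of_partrec (Partrec.nat_iff.1 hf)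

theorem RT.comp {O f g : ℕ → ℕ} (hf : RT O f) (hg : RT O g) : RT O (fun n => f (g n)) :=
  (RecIn.comp hf hg).of_eq (by intro n; simp)

theorem RT.pair {O f g : ℕ → ℕ} (hf : RT O f) (hg : RT O g) :
    RT O (fun n => Nat.pair (f n) (g n)) :=
  (RecIn.pair hf hg).of_eq (by intro n; simp [Seq.seq])

theorem RT_seg (A : Set ℕ) : RT (chi A) (fun m => encode (seg A m)) := by
  have hstep : RT (chi A) (fun p => encode (((decode (α := List Bool) p.unpair.2.unpair.2).getD []) ++
      [decide (chi A p.unpair.2.unpair.1 = 1)])) := by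
    have h1 : RT (chi A) (fun q : ℕ => encode (((decode (α := List Bool) q.unpair.1).getD []) ++
      [decide (q.unpair.2 = 1)])) := by
      refine RT.of_computable (Primrec.to_comp ?_)
      refine Primrec.encode.comp (Primrec.list_concat.comp ?_ ?_)
      · exact Primrec.option_getD.comp (Primrec.decode.comp (Primrec.fst.comp Primrec.unpair)) (Primrec.const [])
      · exact PrimrecPred.decide (Primrec.eq.comp (Primrec.snd.comp Primrec.unpair) (Primrec.const 1))
    have h2 : RT (chi A) (fun p => Nat.pair p.unpair.2.unpair.2 (chi A p.unpair.2.unpair.1)) := by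
      refine RT.pair ?_ (RT.comp (f := chi A) RecIn.oracle ?_)
      · exact RT.of_computable (Primrec.to_comp (Primrec.snd.comp (Primrec.unpair.comp (Primrec.snd.comp Primrec.unpair))))
      · exact RT.of_computable (Primrec.to_comp (Primrec.fst.comp (Primrec.unpair.comp (Primrec.snd.comp Primrec.unpair))))
    exact (h1.comp h2).of_eq (by intro n; simp)
  have hz : RT (chi A) (fun _ => encode ([] : List Bool)) := RT.of_computable (Computable.const _)
  have hp := RecIn.comp (RecIn.prec hz hstep)
    (RT.of_computable (O := chi A) (f := fun m => Nat.pair 0 m)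
      (Primrec₂.natPair.comp (Primrec.const 0) Primrec.id).to_comp)
  refine RecIn.of_eq hp ?_
  intro m
  simp only [Part.bind_eq_bind, Part.bind_some, Nat.unpaired, Nat.unpair_pair]
  induction m with
  | zero => simp [seg]
  | succ m ih =>
    refine (congrArg (fun z : Part ℕ => z.bind _) ih).trans ?_
    simp only [Part.bind_some, encodek, Option.getD_some, seg_succ]
    by_cases h : m ∈ A <;> simp [chi, h]

theorem RT.of_CI {A : Set ℕ} {f : ℕ → ℕ} (hf : CI A f) : RT (chi A) f := by
  obtain ⟨F, cF, sF, eF⟩ := hf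
  let P : ℕ → ℕ := fun q => encode (F ((decode (α := List Bool) q.unpair.1).getD [], q.unpair.2))
  have hP : Computable P := by
    refine Computable.encode.comp (cF.comp (Computable.pair ?_ ?_))
    · exact (Primrec.option_getD.comp (Primrec.decode.comp (Primrec.fst.comp Primrec.unpair)) (Primrec.const [])).to_comp
    · exact Computable.snd.comp Computable.unpair
  have h1 : RT (chi A) (fun q => P (Nat.pair (encode (seg A q.unpair.2)) q.unpair.1)) := by
    refine RT.comp (RT.of_computable hP) (RT.pair (RT.comp (f := fun m => encode (seg A m)) (RT_seg A) ?_) ?_)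
    · exact RT.of_computable (Computable.snd.comp Computable.unpair)
    · exact RT.of_computable (Computable.fst.comp Computable.unpair)
  have h2 : RT (chi A) (fun q => 1 - P (Nat.pair (encode (seg A q.unpair.2)) q.unpair.1)) :=
    RT.comp (f := fun n => 1 - n)
      (RT.of_computable (Primrec.nat_sub.comp (Primrec.const 1) Primrec.id).to_comp) h1
  have h3 := RecIn.rfind h2
  have h4 := RecIn.pair h3 (RT.of_computable (O := chi A) (f := fun n => n) Computable.id)
  have h5 : RT (chi A) (fun q => P (Nat.pair (encode (seg A q.unpair.1)) q.unpair.2) - 1) := by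
    refine RT.comp (f := fun n => n - 1)
      (RT.of_computable (Primrec.nat_sub.comp Primrec.id (Primrec.const 1)).to_comp) ?_
    refine RT.comp (RT.of_computable hP) (RT.pair (RT.comp (f := fun m => encode (seg A m)) (RT_seg A) ?_) ?_)
    · exact RT.of_computable (Computable.fst.comp Computable.unpair)
    · exact RT.of_computable (Computable.snd.comp Computable.unpair)
  refine (RecIn.comp h5 h4).of_eq ?_
  intro a
  obtain ⟨m0, h0⟩ := eF a _ (Part.mem_some _)
  have hex : ∃ m, 1 - P (Nat.pair (encode (seg A m)) a) = 0 := ⟨m0, by simp [P, h0 m0 le_rfl]⟩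
  have hr : (Nat.rfind fun n => (fun m => decide (m = 0)) <$> Part.some (1 - P (Nat.pair (encode (seg A (Nat.pair a n).unpair.2)) (Nat.pair a n).unpair.1))) = Part.some (Nat.find hex) := by
    rw [Part.eq_some_iff]
    refine Nat.mem_rfind.2 ⟨?_, ?_⟩
    · have := Nat.find_spec hex
      simp at this ⊢; exact this
    · intro m hm
      have := Nat.find_min hex hm
      simp at this ⊢; exact this
  rw [hr]
  have hs := Nat.find_spec hex
  generalize Nat.find hex = m at hs
  simp only [Nat.unpair_pair, encodek, P, Option.getD_some] at hs
  rcases hF : F (seg A m, a) with _ | b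
  · simp [hF] at hs
  · have := sF _ _ _ hF
    simp only [Part.mem_some_iff] at this
    simp [Seq.seq, P, hF, this]

theorem CI.of_RT {A : Set ℕ} {f : ℕ → ℕ} (hf : RT (chi A) f) : CI A f :=
  PR.of_recIn CI_chi hf

theorem TRed.of_CI {A B : Set ℕ} (h : CI A (fun n => decide (n ∈ B))) : TRed B A := by
  have : CI A (chi B) := by
    refine (CI.cond h (CI.of_computable (Computable.const 1))
      (CI.of_computable (Computable.const 0))).of_eq ?_
    intro n
    simp only [chi]
    by_cases h : n ∈ B <;> simp [h]
  exact RT.of_CI this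

theorem TRed.toCI {A B : Set ℕ} (h : TRed B A) : CI A (chi B) := CI.of_RT h

theorem exists_ocode {O : ℕ → ℕ} {g : ℕ →. ℕ} (h : RecIn O g) : ∃ c, evalo O c = g := by
  induction h with
  | oracle => exact ⟨.oracle, rfl⟩
  | zero => exact ⟨.zero, rfl⟩
  | succ => exact ⟨.succ, rfl⟩
  | left => exact ⟨.left, rfl⟩
  | right => exact ⟨.right, rfl⟩
  | pair _ _ ihf ihg =>
    obtain ⟨c, rfl⟩ := ihf; obtain ⟨d, rfl⟩ := ihg; exact ⟨.pair c d, rfl⟩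
  | comp _ _ ihf ihg =>
    obtain ⟨c, rfl⟩ := ihf; obtain ⟨d, rfl⟩ := ihg; exact ⟨.comp c d, rfl⟩
  | prec _ _ ihf ihg =>
    obtain ⟨c, rfl⟩ := ihf; obtain ⟨d, rfl⟩ := ihg; exact ⟨.prec c d, rfl⟩
  | rfind _ ih =>
    obtain ⟨c, rfl⟩ := ih
    refine ⟨.comp (.rfind' c) (.pair (.pair .left .right) .zero), ?_⟩
    funext a
    simp [evalo, Seq.seq]
    exact Part.map_id' (fun _ => rfl) _

def oc (b0 b1 : Bool) (m : ℕ) : ℕ := Nat.bit b0 (Nat.bit b1 m) + 5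

theorem ofNat_oc (b0 b1 : Bool) (m : ℕ) : ofNatOCode (oc b0 b1 m) =
    match b0, b1 with
    | false, false => .pair (ofNatOCode m.unpair.1) (ofNatOCode m.unpair.2)
    | false, true  => .comp (ofNatOCode m.unpair.1) (ofNatOCode m.unpair.2)
    | true , false => .prec (ofNatOCode m.unpair.1) (ofNatOCode m.unpair.2)
    | true , true  => .rfind' (ofNatOCode m) := by
  rw [oc, ofNatOCode]
  simp only [Nat.bodd_bit, Nat.div2_bit]
  all_goals (cases b0 <;> cases b1 <;> rfl)

theorem ofNat_surj (c : OCode) : ∃ n, ofNatOCode n = c := by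
  induction c with
  | zero => exact ⟨0, by rw [ofNatOCode]⟩
  | succ => exact ⟨1, by rw [ofNatOCode]⟩
  | left => exact ⟨2, by rw [ofNatOCode]⟩
  | right => exact ⟨3, by rw [ofNatOCode]⟩
  | oracle => exact ⟨4, by rw [ofNatOCode]⟩
  | pair _ _ ih1 ih2 =>
    obtain ⟨a, rfl⟩ := ih1; obtain ⟨b, rfl⟩ := ih2
    exact ⟨oc false false (Nat.pair a b), by rw [ofNat_oc]; simp⟩
  | comp _ _ ih1 ih2 =>
    obtain ⟨a, rfl⟩ := ih1; obtain ⟨b, rfl⟩ := ih2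
    exact ⟨oc false true (Nat.pair a b), by rw [ofNat_oc]; simp⟩
  | prec _ _ ih1 ih2 =>
    obtain ⟨a, rfl⟩ := ih1; obtain ⟨b, rfl⟩ := ih2
    exact ⟨oc true false (Nat.pair a b), by rw [ofNat_oc]; simp⟩
  | rfind' _ ih =>
    obtain ⟨a, rfl⟩ := ih
    exact ⟨oc true true a, by rw [ofNat_oc]⟩

def kc : ℕ → ℕ := fun n => n.rec 0 (fun _ i => oc false true (Nat.pair 1 i))

theorem kc_spec (O : ℕ → ℕ) (n x : ℕ) : evalo O (ofNatOCode (kc n)) x = Part.some n := by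
  induction n generalizing x with
  | zero => show evalo O (ofNatOCode 0) x = _; rw [ofNatOCode]; rfl
  | succ n ih =>
    show evalo O (ofNatOCode (oc false true (Nat.pair 1 (kc n)))) x = _
    rw [ofNat_oc]
    simp only [Nat.unpair_pair, evalo, ih]
    refine (Part.bind_some n (evalo O (ofNatOCode 1))).trans ?_
    rw [ofNatOCode]; rfl

theorem oc_primrec (b0 b1 : Bool) : Primrec (oc b0 b1) := by
  have : oc b0 b1 = fun m => 4 * m + (2 * b1.toNat + b0.toNat + 5) := by
    funext m; cases b0 <;> cases b1 <;> simp [oc, Nat.bit] <;> ring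
  rw [this]
  exact Primrec.nat_add.comp (Primrec.nat_mul.comp (Primrec.const 4) Primrec.id) (Primrec.const _)

theorem kc_primrec : Primrec kc := by
  refine Primrec.nat_rec₁ (f := fun _ i => oc false true (Nat.pair 1 i)) 0 ?_
  exact (oc_primrec _ _).comp (Primrec₂.natPair.comp (Primrec.const 1) Primrec.snd)

theorem CI_dom {A : Set ℕ} {g : ℕ →. ℕ} (h : RecIn (chi A) g) :
    CI (jump A) (fun n => decide (g n).Dom) := by
  obtain ⟨c, hc⟩ := exists_ocode h
  obtain ⟨e, rfl⟩ := ofNat_surj c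
  have := (CI.oracle (A := jump A)).comp (CI.of_primrec (f := fun n => oc false true (Nat.pair e (kc n)))
    ((oc_primrec _ _).comp (Primrec₂.natPair.comp (Primrec.const e) kc_primrec)))
  refine this.of_eq ?_
  intro n
  congr 1
  show (Phi (chi A) _ _).Dom = _
  rw [Phi, ofNat_oc]
  simp only [Nat.unpair_pair, evalo, kc_spec]
  rw [hc]
  exact congrArg Part.Dom (Part.bind_some n g)

section
variable {A : Set ℕ} {α β γ : Type} [Primcodable α] [Primcodable β] [Primcodable γ]

theorem CI_opt {f : γ × α → β} {o : γ → Option α} {d : γ → β} (hf : CI A f) (ho : CI A o)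
    (hd : CI A d) : CI A (fun c => (o c).elim (d c) (fun a => f (c, a))) := by
  obtain ⟨F, cF, sF, eF⟩ := hf
  obtain ⟨O, cO, sO, eO⟩ := ho
  obtain ⟨D, cD, sD, eD⟩ := hd
  refine ⟨fun p => (O p).bind (fun o => Option.casesOn o (D p) (fun a => F (p.1, (p.2, a)))), ?_, ?_, ?_⟩
  · refine Computable.option_bind cO (comp2 ?_)
    refine Computable.option_casesOn Computable.snd (cD.comp Computable.fst) (comp2 ?_)
    refine cF.comp (Computable.pair ?_ (Computable.pair ?_ Computable.snd))
    · exact (Computable.fst.comp (Computable.fst.comp Computable.fst))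
    · exact (Computable.snd.comp (Computable.fst.comp Computable.fst))
  · intro m c b h
    simp only [Option.bind_eq_some_iff] at h
    obtain ⟨o', ho', h⟩ := h
    have h1 := Part.mem_some_iff.1 (sO _ _ _ ho')
    show b ∈ Part.some ((o c).elim (d c) (fun a => f (c, a)))
    rw [← h1]
    cases o' with
    | none => exact sD _ _ _ h
    | some a => exact sF _ _ _ h
  · intro c b h
    change b ∈ Part.some ((o c).elim (d c) (fun a => f (c, a))) at h
    obtain ⟨m0, h0⟩ := eO c _ (Part.mem_some _)
    rcases ho : o c with _ | a
    · rw [ho] at h h0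
      obtain ⟨m1, h1⟩ := eD c _ h
      refine ⟨max m0 m1, fun m hm => ?_⟩
      simp only [h0 m (le_trans (le_max_left _ _) hm), Option.bind_some]
      exact h1 m (le_trans (le_max_right _ _) hm)
    · rw [ho] at h h0
      obtain ⟨m1, h1⟩ := eF (c, a) _ h
      refine ⟨max m0 m1, fun m hm => ?_⟩
      simp only [h0 m (le_trans (le_max_left _ _) hm), Option.bind_some]
      exact h1 m (le_trans (le_max_right _ _) hm)

theorem PR_ofOption {f : α → Option β} (hf : Computable f) :
    PR A (fun a => (f a : Part β)) := by
  refine ⟨fun p => f p.2, hf.comp Computable.snd, ?_, ?_⟩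
  · intro m a b h; exact Part.mem_coe.2 h
  · intro a b h; exact ⟨0, fun m _ => Part.mem_coe.1 h⟩

theorem CI_enc {f : α → β} (hf : CI A f) :
    CI A (fun n : ℕ => encode ((decode (α := α) n).map f)) := by
  have h1 : CI A (fun n : ℕ => (decode (α := α) n).elim 0 (fun a => encode (f a) + 1)) := by
    refine CI_opt (f := fun p : ℕ × α => encode (f p.2) + 1) ?_
      (CI.of_primrec Primrec.decode) (CI.of_primrec (Primrec.const 0))
    exact (CI.of_primrec (f := fun b : β => encode b + 1) (Primrec.succ.comp Primrec.encode)).comp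
      (hf.comp (CI.of_primrec Primrec.snd))
  refine h1.of_eq ?_
  intro n
  cases (decode n : Option α) <;> rfl

theorem CI_of_enc {f : α → β} (hf : CI A (fun n : ℕ => encode ((decode (α := α) n).map f))) :
    CI A f := by
  have h1 : PR A (fun n : ℕ => ((decode (α := Option β) n).join : Part β)) := by
    refine PR_ofOption (Computable.of_eq (f := fun n => ((decode (α := Option β) n).bind id)) ?_ (by intro n; cases (decode (α := Option β) n) <;> rfl))
    exact Computable.option_bind Computable.decode Computable.snd.to₂
  refine (h1.comp (hf.comp (CI.of_primrec Primrec.encode))).of_eq ?_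
  intro a
  simp

theorem CI_mono {B : Set ℕ} (hAB : CI B (chi A)) {f : α → β} (hf : CI A f) : CI B f :=
  CI_of_enc (PR.of_recIn hAB (RT.of_CI (CI_enc hf)))

theorem CI_ex {R : α × ℕ → Bool} (hR : CI A R) :
    CI (jump A) (fun a => decide (∃ y, R (a, y) = true)) := by
  have h1 : CI A (fun q : ℕ => (decode (α := α) q.unpair.1).elim 1
      (fun a => bif R (a, q.unpair.2) then 0 else 1)) := by
    refine CI_opt (f := fun p : ℕ × α => bif R (p.2, p.1.unpair.2) then 0 else 1) ?_
      (CI.of_primrec (Primrec.decode.comp (Primrec.fst.comp Primrec.unpair)))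
      (CI.of_primrec (Primrec.const 1))
    refine CI.cond (hR.comp (CI.of_primrec ?_)) (CI.of_primrec (Primrec.const 0))
      (CI.of_primrec (Primrec.const 1))
    exact Primrec.pair Primrec.snd (Primrec.snd.comp (Primrec.unpair.comp Primrec.fst))
  have h2 := (CI_dom (RecIn.rfind (RT.of_CI h1))).comp (CI.of_primrec (Primrec.encode (α := α)))
  refine h2.of_eq ?_
  intro a
  congr 1
  rw [eq_iff_iff]
  refine Nat.rfind_dom.trans ?_
  simp only [Nat.unpair_pair, encodek, Option.elim_some]
  constructor
  · rintro ⟨y, hy, -⟩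
    refine ⟨y, ?_⟩
    cases h : R (a, y)
    · rw [h] at hy; simp at hy
    · rfl
  · rintro ⟨y, hy⟩
    refine ⟨y, ?_, ?_⟩
    · simp [hy]
    · intro m _; exact trivial

theorem CI_self_jump : CI (jump A) (chi A) := by
  have := CI_ex (A := A) (R := fun p : ℕ × ℕ => decide (p.1 ∈ A))
    (CI.oracle.comp (CI.of_primrec Primrec.fst))
  refine (CI.cond this (CI.of_computable (Computable.const 1))
      (CI.of_computable (Computable.const 0))).of_eq ?_
  intro n
  by_cases h : n ∈ A <;> simp [h, chi]

theorem CI_jump {f : α → β} (hf : CI A f) : CI (jump A) f := CI_mono CI_self_jump hf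

/-- least witness, if there is one -/
noncomputable def mu (R : α × ℕ → Bool) (a : α) : Option ℕ :=
  if h : ∃ y, R (a, y) = true then some (Nat.find h) else none

theorem mu_some {R : α × ℕ → Bool} {a : α} {y : ℕ} (h : mu R a = some y) : R (a, y) = true := by
  unfold mu at h
  split_ifs at h with h1
  simp only [Option.some.injEq] at h
  exact h ▸ Nat.find_spec h1

theorem mu_none {R : α × ℕ → Bool} {a : α} (h : mu R a = none) (y : ℕ) : R (a, y) = false := by
  unfold mu at h
  split_ifs at h with h1
  push Not at h1
  simpa using h1 y

theorem CI_mu {R : α × ℕ → Bool} (hR : CI A R) : CI (jump A) (mu R) := by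
  have h1 : PR (jump A) (fun a => Nat.rfind (fun n => Part.some (R (a, n)))) :=
    PR.rfind (CI_jump hR)
  have h2 : PR (jump A) (fun a => (Nat.rfind (fun n => Part.some (R (a, n)))).bind
      (fun y => Part.some (some y))) :=
    PR.bind h1 (CI.of_primrec (f := fun p : α × ℕ => some p.2)
      (Primrec.option_some.comp Primrec.snd))
  have h3 := PR.cond (CI_ex hR) h2 (CI.of_primrec (f := fun _ => none) (Primrec.const none))
  refine h3.of_eq ?_
  intro a
  by_cases h : ∃ y, R (a, y) = true
  · simp only [mu, h, decide_true, cond_true, dif_pos]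
    have : (Nat.rfind (fun n => Part.some (R (a, n)))) = Part.some (Nat.find h) := by
      rw [Part.eq_some_iff]
      refine Nat.mem_rfind.2 ⟨?_, ?_⟩
      · have := Nat.find_spec h
        simp [this]
      · intro m hm
        have := Nat.find_min h hm
        simpa using this
    rw [this, Part.bind_some]
  · simp only [mu, h, decide_false, cond_false, dif_neg, not_false_iff]

theorem CI_find {R : α × ℕ → Bool} (hR : CI A R) (h : ∀ a, ∃ y, R (a, y) = true) :
    CI A (fun a => Nat.find (h a)) := by
  refine (PR.rfind hR).of_eq ?_
  intro a
  rw [Part.eq_some_iff]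
  refine Nat.mem_rfind.2 ⟨?_, ?_⟩
  · have := Nat.find_spec (h a)
    simp [this]
  · intro m hm
    have := Nat.find_min (h a) hm
    simpa using this

end


def ev (k j : ℕ) (τ : List Bool) (x : ℕ) : Option ℕ :=
  (Nat.Partrec.Code.evaln k (Denumerable.ofNat Nat.Partrec.Code j) (Nat.pair (encode τ) x)).bind
    (fun w => Nat.casesOn w none some)

theorem ev_primrec : Primrec (fun p : ℕ × ℕ × List Bool × ℕ => ev p.1 p.2.1 p.2.2.1 p.2.2.2) := by
  refine Primrec.option_bind (f := fun p : ℕ × ℕ × List Bool × ℕ =>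
    Nat.Partrec.Code.evaln p.1 (Denumerable.ofNat Nat.Partrec.Code p.2.1)
      (Nat.pair (encode p.2.2.1) p.2.2.2)) (g := fun _ w => Nat.casesOn w none some) ?_ ?_
  · refine Nat.Partrec.Code.primrec_evaln.comp (Primrec.pair (Primrec.pair Primrec.fst ?_) ?_)
    · exact (Primrec.ofNat _).comp (Primrec.fst.comp Primrec.snd)
    · refine Primrec₂.natPair.comp ?_ ?_
      · exact Primrec.encode.comp (Primrec.fst.comp (Primrec.snd.comp Primrec.snd))
      · exact (Primrec.snd.comp (Primrec.snd.comp Primrec.snd))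
  · exact Primrec.nat_casesOn Primrec.snd (Primrec.const none)
      (Primrec.option_some.comp Primrec.snd).to₂

theorem ex_index {A : Set ℕ} {f : ℕ → ℕ} (hf : CI A f) :
    ∃ j, (∀ m k x v, ev k j (seg A m) x = some v → v = f x) ∧
      ∀ x, ∃ m0, ∀ m ≥ m0, ∃ k0, ∀ k ≥ k0, ev k j (seg A m) x = some (f x) := by
  obtain ⟨F, cF, sF, eF⟩ := hf
  let P : ℕ → ℕ := fun q => encode (F ((decode (α := List Bool) q.unpair.1).getD [], q.unpair.2))
  have hP : Computable P := by
    refine Computable.encode.comp (cF.comp (Computable.pair ?_ ?_))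
    · exact (Primrec.option_getD.comp (Primrec.decode.comp (Primrec.fst.comp Primrec.unpair)) (Primrec.const [])).to_comp
    · exact Computable.snd.comp Computable.unpair
  obtain ⟨c, hc⟩ := Nat.Partrec.Code.exists_code.1 (Partrec.nat_iff.1 hP)
  have hcP : ∀ q, c.eval q = Part.some (P q) := fun q => congrFun hc q
  have hPv : ∀ m x, P (Nat.pair (encode (seg A m)) x) = encode (F (seg A m, x)) := by
    intro m x; simp [P]
  refine ⟨encode c, ?_, ?_⟩
  · intro m k x v h
    simp only [ev, Denumerable.ofNat_encode, Option.bind_eq_some_iff] at h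
    obtain ⟨w, hw, h⟩ := h
    have := Nat.Partrec.Code.evaln_sound hw
    rw [hcP, Part.mem_some_iff, hPv] at this
    cases w with
    | zero => simp at h
    | succ w =>
      simp only [Option.some.injEq] at h
      subst h
      rcases hF : F (seg A m, x) with _ | b
      · rw [hF] at this; simp at this
      · rw [hF] at this; simp at this
        rw [this]
        exact Part.mem_some_iff.1 (sF _ _ _ hF)
  · intro x
    obtain ⟨m0, h0⟩ := eF x _ (Part.mem_some _)
    refine ⟨m0, fun m hm => ?_⟩
    have h1 : f x + 1 ∈ c.eval (Nat.pair (encode (seg A m)) x) := by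
      rw [hcP, hPv, h0 m hm]; simp
    obtain ⟨k0, hk0⟩ := Nat.Partrec.Code.evaln_complete.1 h1
    refine ⟨k0, fun k hk => ?_⟩
    have h2 := Nat.Partrec.Code.evaln_mono hk hk0
    simp only [ev, Denumerable.ofNat_encode]
    rw [Option.mem_def.1 h2]
    rfl

theorem j0_ex : ∃ j, (∀ m k x v, ev k j (seg K m) x = some v → v = (fun _ : ℕ => Nat.pair 1 0) x) ∧
      ∀ x, ∃ m0, ∀ m ≥ m0, ∃ k0, ∀ k ≥ k0, ev k j (seg K m) x = some ((fun _ : ℕ => Nat.pair 1 0) x) :=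
  ex_index (A := K) (f := fun _ => Nat.pair 1 0) (CI.of_primrec (Primrec.const _))

noncomputable def j0 : ℕ := j0_ex.choose

theorem j0_sound (m k x v : ℕ) (h : ev k j0 (seg K m) x = some v) : v = Nat.pair 1 0 :=
  j0_ex.choose_spec.1 m k x v h
theorem j0_conv (x : ℕ) : ∃ m0, ∀ m ≥ m0, ∃ k0, ∀ k ≥ k0, ev k j0 (seg K m) x = some (Nat.pair 1 0) :=
  j0_ex.choose_spec.2 x

/-- requirement: (σ, k, c, pol, B, Q) -/
abbrev Rq := List Bool × ℕ × ℕ × Bool × List ℕ × List ℕ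

def okpos (rq : Rq) (z : List Bool) (q : ℕ) : Prop :=
  rq.2.1 ≤ q.unpair.1 ∨ q.unpair.1 = j0 ∨ q ∈ rq.2.2.2.2.2 ∨
    (q.unpair.1 ∉ rq.2.2.2.2.1 ∧ z[q]? = some true)

def validC (rq : Rq) (z : List Bool) (w : ℕ) (y : List Bool × ℕ × ℕ) : Prop :=
  y.1.take rq.1.length = rq.1 ∧ y.1.length ≤ w ∧ Nat.pair j0 y.2.1 < w ∧
    ev y.2.2 rq.2.2.1 y.1 y.2.1 = some 1 ∧
    ∀ q ∈ List.range y.1.length, q < rq.1.length ∨ ¬ y.1[q]? = some true ∨ okpos rq z q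

noncomputable def valid (rq : Rq) (z : List Bool) (w : ℕ) : Option ℕ :=
  (decode (α := List Bool × ℕ × ℕ) w).bind fun y =>
    if validC rq z w y then some (Nat.pair j0 y.2.1) else none

noncomputable def lstep (rq : Rq) (m : ℕ) (z : List Bool) (w : ℕ) (L : List ℕ) : List ℕ :=
  (valid rq z w).elim L (fun p => if p ∉ L ∧ L.length < m then p :: L else L)

noncomputable def Lr (rq : Rq) (m : ℕ) (z : List Bool) (t : ℕ) : List ℕ :=
  t.rec [] (fun w L => lstep rq m z w L)

def Ec (rq : Rq) (r : ℕ) (z : List Bool) : Prop :=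
  (Lr rq (r+2) z z.length).length = r + 2 ∧ ∀ q ∈ Lr rq (r+2) z z.length, z[q]? = some rq.2.2.2.1

def Er (r : ℕ) (z : List Bool) : Prop := ∃ rq : Rq, decode r = some rq ∧ Ec rq r z

def EE (z : List Bool) : Prop := ∃ r ∈ List.range z.length, Er r z

section prim
variable {α β γ : Type} [Primcodable α] [Primcodable β] [Primcodable γ]

theorem pr_elim {o : α → Option β} {d : α → γ} {f : α → β → γ} (ho : Primrec o) (hd : Primrec d)
    (hf : Primrec₂ f) : Primrec (fun a => (o a).elim (d a) (f a)) :=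
  (Primrec.option_casesOn ho hd hf).of_eq (by intro a; cases o a <;> rfl)

theorem pr_mem {f : α → ℕ} {L : α → List ℕ} (hf : Primrec f) (hL : Primrec L) :
    PrimrecPred (fun a => f a ∈ L a) := by
  have h : PrimrecRel (fun (L : List ℕ) (x : ℕ) => ∃ a ∈ L, a = x) :=
    PrimrecRel.exists_mem_list (R := fun a b : ℕ => a = b) Primrec.eq
  exact (PrimrecPred.comp (p := fun q : List ℕ × ℕ => ∃ a ∈ q.1, a = q.2) h (Primrec.pair hL hf)).of_eq (by intro a; simp)

theorem pr_forall {L : α → List β} {p : α → β → Prop} (hL : Primrec L)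
    (hp : PrimrecPred (fun q : α × β => p q.1 q.2)) : PrimrecPred (fun a => ∀ b ∈ L a, p a b) := by
  have h : PrimrecRel (fun (L : List β) (a : α) => ∀ b ∈ L, p a b) :=
    PrimrecRel.forall_mem_list (R := fun b a => p a b) (hp.comp (Primrec.pair Primrec.snd Primrec.fst))
  exact PrimrecPred.comp (p := fun q : List β × α => ∀ b ∈ q.1, p q.2 b) h (Primrec.pair hL Primrec.id)

theorem pr_exists {L : α → List β} {p : α → β → Prop} (hL : Primrec L)
    (hp : PrimrecPred (fun q : α × β => p q.1 q.2)) : PrimrecPred (fun a => ∃ b ∈ L a, p a b) := by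
  have h : PrimrecRel (fun (L : List β) (a : α) => ∃ b ∈ L, p a b) :=
    PrimrecRel.exists_mem_list (R := fun b a => p a b) (hp.comp (Primrec.pair Primrec.snd Primrec.fst))
  exact PrimrecPred.comp (p := fun q : List β × α => ∃ b ∈ q.1, p q.2 b) h (Primrec.pair hL Primrec.id)

theorem pr_eqc {f : α → β} (hf : Primrec f) (b : β) : PrimrecPred (fun a => f a = b) :=
  PrimrecPred.comp (p := fun q : β × β => q.1 = q.2) Primrec.eq (Primrec.pair hf (Primrec.const b))

theorem pr_eq {f g : α → β} (hf : Primrec f) (hg : Primrec g) : PrimrecPred (fun a => f a = g a) :=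
  PrimrecPred.comp (p := fun q : β × β => q.1 = q.2) Primrec.eq (Primrec.pair hf hg)

theorem pr_le {f g : α → ℕ} (hf : Primrec f) (hg : Primrec g) : PrimrecPred (fun a => f a ≤ g a) :=
  PrimrecPred.comp (p := fun q : ℕ × ℕ => q.1 ≤ q.2) Primrec.nat_le (Primrec.pair hf hg)

theorem pr_lt {f g : α → ℕ} (hf : Primrec f) (hg : Primrec g) : PrimrecPred (fun a => f a < g a) :=
  PrimrecPred.comp (p := fun q : ℕ × ℕ => q.1 < q.2) Primrec.nat_lt (Primrec.pair hf hg)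

theorem pr_get {f : α → List β} {g : α → ℕ} (hf : Primrec f) (hg : Primrec g) :
    Primrec (fun a => (f a)[g a]?) := Primrec.list_getElem?.comp hf hg

theorem pr_un1 {f : α → ℕ} (hf : Primrec f) : Primrec (fun a => (f a).unpair.1) :=
  Primrec.fst.comp (Primrec.unpair.comp hf)
theorem pr_un2 {f : α → ℕ} (hf : Primrec f) : Primrec (fun a => (f a).unpair.2) :=
  Primrec.snd.comp (Primrec.unpair.comp hf)
end prim

theorem okpos_pr : PrimrecPred (fun p : Rq × List Bool × ℕ => okpos p.1 p.2.1 p.2.2) := by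
  have hq : Primrec (fun p : Rq × List Bool × ℕ => p.2.2) := Primrec.snd.comp Primrec.snd
  have h0 : Primrec (fun p : Rq × List Bool × ℕ => p.1.2.2.2.2) :=
    Primrec.snd.comp (Primrec.snd.comp (Primrec.snd.comp (Primrec.snd.comp Primrec.fst)))
  refine (pr_le (Primrec.fst.comp (Primrec.snd.comp Primrec.fst)) (pr_un1 hq)).or
    ((pr_eqc (pr_un1 hq) j0).or ((pr_mem hq (Primrec.snd.comp h0)).or
      ((pr_mem (pr_un1 hq) (Primrec.fst.comp h0)).not.and ?_)))
  exact pr_eqc (pr_get (Primrec.fst.comp Primrec.snd) hq) _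

theorem validC_pr : PrimrecPred
    (fun p : (Rq × List Bool × ℕ) × (List Bool × ℕ × ℕ) => validC p.1.1 p.1.2.1 p.1.2.2 p.2) := by
  have hσ : Primrec (fun p : (Rq × List Bool × ℕ) × (List Bool × ℕ × ℕ) => p.1.1.1) :=
    Primrec.fst.comp (Primrec.fst.comp Primrec.fst)
  have hw : Primrec (fun p : (Rq × List Bool × ℕ) × (List Bool × ℕ × ℕ) => p.1.2.2) :=
    Primrec.snd.comp (Primrec.snd.comp Primrec.fst)
  have hτ : Primrec (fun p : (Rq × List Bool × ℕ) × (List Bool × ℕ × ℕ) => p.2.1) :=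
    Primrec.fst.comp Primrec.snd
  have hx : Primrec (fun p : (Rq × List Bool × ℕ) × (List Bool × ℕ × ℕ) => p.2.2.1) :=
    Primrec.fst.comp (Primrec.snd.comp Primrec.snd)
  have hu : Primrec (fun p : (Rq × List Bool × ℕ) × (List Bool × ℕ × ℕ) => p.2.2.2) :=
    Primrec.snd.comp (Primrec.snd.comp Primrec.snd)
  have hc : Primrec (fun p : (Rq × List Bool × ℕ) × (List Bool × ℕ × ℕ) => p.1.1.2.2.1) :=
    Primrec.fst.comp (Primrec.snd.comp (Primrec.snd.comp (Primrec.fst.comp Primrec.fst)))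
  refine (pr_eq (Primrec.list_take.comp (Primrec.list_length.comp hσ) hτ) hσ).and
    ((pr_le (Primrec.list_length.comp hτ) hw).and ((pr_lt (Primrec₂.natPair.comp (Primrec.const j0) hx) hw).and
    ((pr_eqc (ev_primrec.comp (Primrec.pair hu (Primrec.pair hc (Primrec.pair hτ hx)))) _).and ?_)))
  refine pr_forall (Primrec.list_range.comp (Primrec.list_length.comp hτ)) ?_
  refine (pr_lt Primrec.snd (Primrec.list_length.comp (hσ.comp Primrec.fst))).or
    ((pr_eqc (pr_get (hτ.comp Primrec.fst) Primrec.snd) _).not.or ?_)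
  refine okpos_pr.comp (Primrec.pair (Primrec.fst.comp (Primrec.fst.comp Primrec.fst))
    (Primrec.pair ?_ Primrec.snd))
  exact Primrec.fst.comp (Primrec.snd.comp (Primrec.fst.comp Primrec.fst))

theorem valid_pr : Primrec (fun p : Rq × List Bool × ℕ => valid p.1 p.2.1 p.2.2) := by
  refine Primrec.option_bind (Primrec.decode.comp (Primrec.snd.comp Primrec.snd)) ?_
  refine Primrec.ite validC_pr ?_ (Primrec.const none)
  exact Primrec.option_some.comp (Primrec₂.natPair.comp (Primrec.const j0)
    (Primrec.fst.comp (Primrec.snd.comp Primrec.snd)))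

theorem lstep_pr : Primrec (fun p : (Rq × ℕ × List Bool) × (ℕ × List ℕ) =>
    lstep p.1.1 p.1.2.1 p.1.2.2 p.2.1 p.2.2) := by
  have hL : Primrec (fun p : (Rq × ℕ × List Bool) × (ℕ × List ℕ) => p.2.2) :=
    Primrec.snd.comp Primrec.snd
  have hv : Primrec (fun p : (Rq × ℕ × List Bool) × (ℕ × List ℕ) => valid p.1.1 p.1.2.2 p.2.1) := by
    refine valid_pr.comp (Primrec.pair ?_ (Primrec.pair ?_ ?_))
    · exact Primrec.fst.comp Primrec.fst
    · exact Primrec.snd.comp (Primrec.snd.comp Primrec.fst)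
    · exact Primrec.fst.comp Primrec.snd
  have hm : Primrec (fun p : (Rq × ℕ × List Bool) × (ℕ × List ℕ) => p.1.2.1) :=
    Primrec.fst.comp (Primrec.snd.comp Primrec.fst)
  refine pr_elim hv hL ?_
  have h1 : PrimrecPred (fun q : ((Rq × ℕ × List Bool) × (ℕ × List ℕ)) × ℕ =>
      q.2 ∉ q.1.2.2 ∧ q.1.2.2.length < q.1.1.2.1) :=
    PrimrecPred.and (PrimrecPred.not (pr_mem Primrec.snd (hL.comp Primrec.fst)))
      (pr_lt (Primrec.list_length.comp (hL.comp Primrec.fst)) (hm.comp Primrec.fst))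
  exact Primrec.ite h1 (Primrec.list_cons.comp Primrec.snd (hL.comp Primrec.fst)) (hL.comp Primrec.fst)

theorem Lr_pr : Primrec (fun p : (Rq × ℕ × List Bool) × ℕ => Lr p.1.1 p.1.2.1 p.1.2.2 p.2) :=
  Primrec.nat_rec (f := fun _ : Rq × ℕ × List Bool => ([] : List ℕ))
    (g := fun a q => lstep a.1 a.2.1 a.2.2 q.1 q.2) (Primrec.const []) lstep_pr

theorem Ec_pr : PrimrecPred (fun p : (ℕ × List Bool) × Rq => Ec p.2 p.1.1 p.1.2) := by
  have hz : Primrec (fun p : (ℕ × List Bool) × Rq => p.1.2) := Primrec.snd.comp Primrec.fst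
  have hr : Primrec (fun p : (ℕ × List Bool) × Rq => p.1.1+2) :=
    Primrec.nat_add.comp (Primrec.fst.comp Primrec.fst) (Primrec.const 2)
  have hL : Primrec (fun p : (ℕ × List Bool) × Rq => Lr p.2 (p.1.1+2) p.1.2 p.1.2.length) :=
    Lr_pr.comp (Primrec.pair (Primrec.pair Primrec.snd (Primrec.pair hr hz)) (Primrec.list_length.comp hz))
  refine (pr_eq (Primrec.list_length.comp hL) hr).and (pr_forall hL ?_)
  refine pr_eq (pr_get (hz.comp Primrec.fst) Primrec.snd) (Primrec.option_some.comp ?_)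
  exact Primrec.fst.comp (Primrec.snd.comp (Primrec.snd.comp (Primrec.snd.comp (Primrec.snd.comp Primrec.fst))))

theorem Er_pr : PrimrecPred (fun p : ℕ × List Bool => Er p.1 p.2) := by
  have h : Primrec (fun p : ℕ × List Bool => (decode (α := Rq) p.1).elim false
      (fun rq => decide (Ec rq p.1 p.2))) :=
    pr_elim (Primrec.decode.comp Primrec.fst) (Primrec.const false) Ec_pr.decide
  refine (pr_eqc h true).of_eq ?_
  intro p
  rcases hd : (decode (α := Rq) p.1) with _ | rq <;> simp [Er, hd]

theorem EE_pr : PrimrecPred EE := by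
  refine pr_exists (Primrec.list_range.comp Primrec.list_length) ?_
  exact Er_pr.comp (Primrec.pair Primrec.snd Primrec.fst)


theorem validC_congr {rq : Rq} {z z' : List Bool} {w : ℕ} {y : List Bool × ℕ × ℕ}
    (h : ∀ q < w, q.unpair.1 ≠ j0 → z[q]? = z'[q]?) (hv : validC rq z w y) : validC rq z' w y := by
  obtain ⟨h1, h2, h3, h4, h5⟩ := hv
  refine ⟨h1, h2, h3, h4, fun q hq => ?_⟩
  rcases h5 q hq with h6 | h6 | h6
  · exact Or.inl h6
  · exact Or.inr (Or.inl h6)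
  · refine Or.inr (Or.inr ?_)
    rcases h6 with h6 | h6 | h6 | h6
    · exact Or.inl h6
    · exact Or.inr (Or.inl h6)
    · exact Or.inr (Or.inr (Or.inl h6))
    · by_cases hj : q.unpair.1 = j0
      · exact Or.inr (Or.inl hj)
      · refine Or.inr (Or.inr (Or.inr ⟨h6.1, ?_⟩))
        rw [← h q (by have := List.mem_range.1 hq; omega) hj]; exact h6.2

theorem valid_congr {rq : Rq} {z z' : List Bool} {w : ℕ}
    (h : ∀ q < w, q.unpair.1 ≠ j0 → z[q]? = z'[q]?) : valid rq z w = valid rq z' w := by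
  unfold valid
  congr 1
  funext y
  have : validC rq z w y ↔ validC rq z' w y :=
    ⟨validC_congr h, validC_congr (fun q hq hj => (h q hq hj).symm)⟩
  simp only [this]

theorem Lr_succ (rq : Rq) (m : ℕ) (z : List Bool) (t : ℕ) :
    Lr rq m z (t+1) = lstep rq m z t (Lr rq m z t) := rfl

theorem Lr_congr {rq : Rq} {m : ℕ} {z z' : List Bool} {t : ℕ}
    (h : ∀ q < t, q.unpair.1 ≠ j0 → z[q]? = z'[q]?) : Lr rq m z t = Lr rq m z' t := by
  induction t with
  | zero => rfl
  | succ t ih =>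
    rw [Lr_succ, Lr_succ, ih (fun q hq => h q (by omega)), lstep, lstep,
      valid_congr (fun q hq => h q (by omega))]

theorem valid_some {rq : Rq} {z : List Bool} {w p : ℕ} (h : valid rq z w = some p) :
    p < w ∧ p.unpair.1 = j0 ∧ ∃ y : List Bool × ℕ × ℕ, decode w = some y ∧ validC rq z w y ∧
      p = Nat.pair j0 y.2.1 := by
  unfold valid at h
  rw [Option.bind_eq_some_iff] at h
  obtain ⟨y, hy, h⟩ := h
  split_ifs at h with hv
  simp only [Option.some.injEq] at h
  refine ⟨h ▸ hv.2.2.1, by rw [← h]; simp, y, hy, hv, h.symm⟩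

theorem Lr_props (rq : Rq) (m : ℕ) (z : List Bool) (t : ℕ) :
    (Lr rq m z t).Nodup ∧ (Lr rq m z t).length ≤ m ∧
    (∀ p ∈ Lr rq m z t, ∃ w < t, valid rq z w = some p) ∧
    ((Lr rq m z t).length < m → ∀ w < t, ∀ p, valid rq z w = some p → p ∈ Lr rq m z t) := by
  induction t with
  | zero => simp [Lr]
  | succ t ih =>
    obtain ⟨h1, h2, h3, h4⟩ := ih
    rw [Lr_succ, lstep]
    rcases hv : valid rq z t with _ | p
    · simp only [Option.elim_none]
      refine ⟨h1, h2, fun p hp => ?_, fun hl w hw p hp => ?_⟩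
      · obtain ⟨w, hw, h⟩ := h3 p hp; exact ⟨w, by omega, h⟩
      · rcases Nat.lt_succ_iff_lt_or_eq.1 hw with hw | rfl
        · exact h4 hl w hw p hp
        · rw [hv] at hp; simp at hp
    · simp only [Option.elim_some]
      split_ifs with hc
      · refine ⟨List.nodup_cons.2 ⟨hc.1, h1⟩, by simp; omega, fun p' hp => ?_, fun hl w hw p' hp => ?_⟩
        · rcases List.mem_cons.1 hp with rfl | hp
          · exact ⟨t, by omega, hv⟩
          · obtain ⟨w, hw, h⟩ := h3 p' hp; exact ⟨w, by omega, h⟩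
        · rcases Nat.lt_succ_iff_lt_or_eq.1 hw with hw | rfl
          · exact List.mem_cons_of_mem _ (h4 hc.2 w hw p' hp)
          · rw [hv] at hp; simp at hp; simp [hp]
      · refine ⟨h1, h2, fun p hp => ?_, fun hl w hw p' hp => ?_⟩
        · obtain ⟨w, hw, h⟩ := h3 p hp; exact ⟨w, by omega, h⟩
        · rcases Nat.lt_succ_iff_lt_or_eq.1 hw with hw | rfl
          · exact h4 hl w hw p' hp
          · rw [hv] at hp; simp at hp; subst hp
            by_contra hcc
            exact hc ⟨hcc, hl⟩

theorem Lr_stable {rq : Rq} {m : ℕ} {z : List Bool} {t t' : ℕ} (h : (Lr rq m z t).length = m)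
    (ht : t ≤ t') : Lr rq m z t' = Lr rq m z t := by
  induction t', ht using Nat.le_induction with
  | base => rfl
  | succ n hn ih =>
    rw [Lr_succ, ih, lstep]
    rcases hv : valid rq z n with _ | p
    · rfl
    · simp [h]

theorem Lr_mem_lt {rq : Rq} {m : ℕ} {z : List Bool} {t p : ℕ} (h : p ∈ Lr rq m z t) :
    p < t ∧ p.unpair.1 = j0 := by
  obtain ⟨w, hw, hv⟩ := (Lr_props rq m z t).2.2.1 p h
  have := valid_some hv
  exact ⟨by omega, this.2.1⟩

theorem EE_append {z : List Bool} (b : Bool) (h : EE z) : EE (z ++ [b]) := by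
  obtain ⟨r, hr, rq, hd, hE1, hE2⟩ := h
  refine ⟨r, by simp at hr ⊢; omega, rq, hd, ?_⟩
  have hL : Lr rq (r+2) (z ++ [b]) (z ++ [b]).length = Lr rq (r+2) z z.length := by
    have h1 : Lr rq (r+2) (z ++ [b]) z.length = Lr rq (r+2) z z.length :=
      Lr_congr (fun q hq _ => by rw [List.getElem?_append_left hq])
    rw [← h1]
    exact Lr_stable (by rw [h1]; exact hE1) (by simp)
  unfold Ec
  rw [hL]
  refine ⟨hE1, fun q hq => ?_⟩
  rw [List.getElem?_append_left (Lr_mem_lt hq).1]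
  exact hE2 q hq

def allstr : ℕ → List (List Bool) := fun t =>
  t.rec [[]] (fun _ L => L.map (· ++ [false]) ++ L.map (· ++ [true]))

theorem allstr_succ (t : ℕ) : allstr (t+1) =
    (allstr t).map (· ++ [false]) ++ (allstr t).map (· ++ [true]) := rfl

theorem allstr_pr : Primrec allstr := by
  refine Primrec.nat_rec₁ (f := fun _ (L : List (List Bool)) => L.map (· ++ [false]) ++ L.map (· ++ [true])) [[]] ?_
  refine Primrec.list_append.comp ?_ ?_
  · exact Primrec.list_map Primrec.snd (Primrec.list_concat.comp Primrec.snd (Primrec.const false))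
  · exact Primrec.list_map Primrec.snd (Primrec.list_concat.comp Primrec.snd (Primrec.const true))

theorem mem_allstr (t : ℕ) (z : List Bool) : z ∈ allstr t ↔ z.length = t := by
  induction t generalizing z with
  | zero => simp [allstr]
  | succ t ih =>
    rw [allstr_succ]
    simp only [List.mem_append, List.mem_map, ih]
    constructor
    · rintro (⟨a, h, rfl⟩ | ⟨a, h, rfl⟩) <;> simp [h]
    · intro h
      have hne : z ≠ [] := by rintro rfl; simp at h
      have := List.dropLast_append_getLast hne
      cases hb : z.getLast hne
      · left; exact ⟨z.dropLast, by simp [h], by rw [← hb]; exact this⟩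
      · right; exact ⟨z.dropLast, by simp [h], by rw [← hb]; exact this⟩

theorem allstr_nodup (t : ℕ) : (allstr t).Nodup := by
  induction t with
  | zero => simp [allstr]
  | succ t ih =>
    rw [allstr_succ, List.nodup_append']
    refine ⟨ih.map (fun a b h => by simpa using h), ih.map (fun a b h => by simpa using h), ?_⟩
    intro z h1 h2
    obtain ⟨a, -, rfl⟩ := List.mem_map.1 h1
    obtain ⟨b, -, h⟩ := List.mem_map.1 h2
    have := (List.append_inj' h rfl).2
    simp at this

theorem allstr_len (t : ℕ) : (allstr t).length = 2 ^ t := by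
  induction t with
  | zero => simp [allstr]
  | succ t ih => rw [allstr_succ]; simp [ih]; ring

noncomputable def SS (t : ℕ) : Finset (List Bool) := (allstr t).toFinset

theorem mem_SS {t : ℕ} {z : List Bool} : z ∈ SS t ↔ z.length = t := by simp [SS, mem_allstr]

theorem SS_card (t : ℕ) : (SS t).card = 2 ^ t := by
  rw [SS, List.toFinset_card_of_nodup (allstr_nodup t), allstr_len]

theorem countP_SS (t : ℕ) (p : List Bool → Prop) [DecidablePred p] :
    (allstr t).countP (fun z => decide (p z)) = ((SS t).filter p).card := by
  rw [List.countP_eq_length_filter, ← List.toFinset_card_of_nodup ((allstr_nodup t).filter _)]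
  congr 1
  ext z
  simp [SS]

noncomputable def flip' (z : List Bool) (Y : Finset ℕ) : List Bool :=
  z.mapIdx (fun i b => xor b (decide (i ∈ Y)))

theorem flip_len (z : List Bool) (Y : Finset ℕ) : (flip' z Y).length = z.length := by simp [flip']

theorem flip_get (z : List Bool) (Y : Finset ℕ) (i : ℕ) :
    (flip' z Y)[i]? = z[i]?.map (fun b => xor b (decide (i ∈ Y))) := by
  simp [flip', List.getElem?_mapIdx]

theorem flip'_flip' (z : List Bool) (Y : Finset ℕ) : flip' (flip' z Y) Y = z := by
  apply List.ext_getElem?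
  intro i
  rw [flip_get, flip_get]
  cases z[i]? <;> simp

theorem Er_count (r t : ℕ) : ((SS t).filter (Er r)).card * 2 ^ (r+2) ≤ 2 ^ t := by
  rcases hd : (decode (α := Rq) r) with _ | rq
  · have : (SS t).filter (Er r) = ∅ := by
      apply Finset.filter_eq_empty_iff.2
      rintro z - ⟨rq, h, -⟩
      rw [hd] at h; simp at h
    rw [this]; simp
  · set S := (SS t).filter (Er r) with hS
    have hE : ∀ z ∈ S, z.length = t ∧ (Lr rq (r+2) z t).length = r + 2 ∧ ∀ q ∈ Lr rq (r+2) z t, z[q]? = some rq.2.2.2.1 := by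
      intro z hz
      rw [hS, Finset.mem_filter, mem_SS] at hz
      obtain ⟨h1, rq', h2, h3⟩ := hz
      rw [hd] at h2
      simp only [Option.some.injEq] at h2
      subst h2
      unfold Ec at h3
      rw [h1] at h3
      exact ⟨h1, h3⟩
    have hc : (S.sigma (fun z => (Lr rq (r+2) z t).toFinset.powerset)).card = S.card * 2 ^ (r+2) := by
      rw [Finset.card_sigma, Finset.sum_congr rfl (g := fun _ => 2^(r+2)), Finset.sum_const, smul_eq_mul]
      intro z hz
      rw [Finset.card_powerset, List.toFinset_card_of_nodup (Lr_props rq (r+2) z t).1, (hE z hz).2.1]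
    rw [← hc, ← SS_card]
    have hLf : ∀ z : List Bool, ∀ Y ⊆ (Lr rq (r+2) z t).toFinset, Lr rq (r+2) (flip' z Y) t = Lr rq (r+2) z t := by
      intro z Y hY
      apply Lr_congr
      intro q hq hj
      rw [flip_get]
      have : q ∉ Y := fun h => hj (Lr_mem_lt (List.mem_toFinset.1 (hY h))).2
      cases z[q]? <;> simp [this]
    refine Finset.card_le_card_of_injOn (fun p => flip' p.1 p.2) ?_ ?_
    · rintro ⟨z, Y⟩ h
      simp only [Finset.coe_sigma, Set.mem_sigma_iff, Finset.mem_coe] at h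
      simp only [Finset.mem_coe, mem_SS, flip_len]
      exact (hE z h.1).1
    · rintro ⟨z, Y⟩ h ⟨z', Y'⟩ h' heq
      simp only [Finset.coe_sigma, Set.mem_sigma_iff, Finset.mem_coe, Finset.mem_powerset] at h h'
      simp only at heq
      have hL : Lr rq (r+2) z t = Lr rq (r+2) z' t := by
        rw [← hLf z Y h.2, heq, hLf z' Y' h'.2]
      have hY : Y = Y' := by
        ext q
        by_cases hq : q ∈ Lr rq (r+2) z t
        · have h1 := (hE z h.1).2.2 q hq
          have h2 := (hE z' h'.1).2.2 q (hL ▸ hq)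
          have h3 := congrArg (fun l : List Bool => l[q]?) heq
          simp only [flip_get, h1, h2, Option.map_some, Option.some.injEq] at h3
          have h4 := Bool.xor_right_inj.1 h3
          simpa using h4
        · constructor
          · intro hh; exact absurd (List.mem_toFinset.1 (h.2 hh)) hq
          · intro hh; exact absurd (List.mem_toFinset.1 (h'.2 hh)) (hL ▸ hq)
      subst hY
      have : z = z' := by rw [← flip'_flip' z Y, heq, flip'_flip']
      subst this
      rfl

theorem EE_count (t : ℕ) : (((SS t).filter EE).card : ℚ) / 2 ^ t ≤ 1 / 2 := by
  have h1 : ((SS t).filter EE).card ≤ ∑ r ∈ Finset.range t, ((SS t).filter (Er r)).card := by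
    refine le_trans (Finset.card_le_card ?_) Finset.card_biUnion_le
    intro z hz
    rw [Finset.mem_filter] at hz
    obtain ⟨hz, r, hr, hE⟩ := hz
    rw [mem_SS] at hz
    refine Finset.mem_biUnion.2 ⟨r, ?_, Finset.mem_filter.2 ⟨mem_SS.2 hz, hE⟩⟩
    rw [hz] at hr
    simpa using hr
  have h2 : ∀ n : ℕ, ∑ r ∈ Finset.range n, (1 / 2 ^ (r+2) : ℚ) = 1/2 - 1 / 2^(n+1) := by
    intro n
    induction n with
    | zero => norm_num
    | succ n ih => rw [Finset.sum_range_succ, ih]; field_simp; ring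
  rw [div_le_iff₀ (by positivity)]
  calc (((SS t).filter EE).card : ℚ) ≤ ∑ r ∈ Finset.range t, (((SS t).filter (Er r)).card : ℚ) := by
        exact_mod_cast h1
    _ ≤ ∑ r ∈ Finset.range t, (1 / 2 ^ (r+2) : ℚ) * 2 ^ t := by
        refine Finset.sum_le_sum (fun r _ => ?_)
        have := Er_count r t
        rw [div_mul_eq_mul_div, one_mul, le_div_iff₀ (by positivity)]
        exact_mod_cast this
    _ = (1/2 - 1 / 2^(t+1)) * 2 ^ t := by rw [← Finset.sum_mul, h2]
    _ ≤ 1 / 2 * 2 ^ t := by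
        refine mul_le_mul_of_nonneg_right ?_ (by positivity)
        have : (0:ℚ) ≤ 1 / 2^(t+1) := by positivity
        linarith

/-- events: (position, bit, (numerator, denominator - 1)) -/
abbrev Evt := ℕ × Bool × (ℕ × ℕ)
abbrev Hist := List Evt

def consist (h : Hist) (z : List Bool) : Prop := ∀ e ∈ h, z[e.1]? = some e.2.1

noncomputable def cnt (h : Hist) (t : ℕ) : ℕ :=
  (allstr t).countP (fun z => decide (consist h z ∧ EE z))

theorem cnt_eq (h : Hist) (t : ℕ) : cnt h t = ((SS t).filter (fun z => consist h z ∧ EE z)).card :=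
  countP_SS t _

theorem cnt_nil (t : ℕ) : (cnt [] t : ℚ) / 2 ^ t ≤ 1 / 2 := by
  rw [cnt_eq]
  simpa [consist] using EE_count t

theorem cnt_split (q : ℕ) (v v' : ℕ × ℕ) (h : Hist) (t : ℕ) :
    cnt ((q, false, v) :: h) t + cnt ((q, true, v') :: h) t ≤ cnt h t := by
  rw [cnt_eq, cnt_eq, cnt_eq, ← Finset.card_union_of_disjoint]
  · apply Finset.card_le_card
    intro z hz
    simp only [Finset.mem_union, Finset.mem_filter] at hz ⊢
    simp only [consist, List.forall_mem_cons] at hz ⊢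
    tauto
  · rw [Finset.disjoint_left]
    intro z h1 h2
    simp only [consist, Finset.mem_filter, List.forall_mem_cons] at h1 h2
    have := h1.2.1.1.symm.trans h2.2.1.1
    simp at this

theorem cnt_mono (h : Hist) (t : ℕ) : 2 * cnt h t ≤ cnt h (t+1) := by
  unfold cnt
  rw [allstr_succ, List.countP_append, List.countP_map, List.countP_map]
  have key : ∀ b : Bool, (allstr t).countP (fun z => decide (consist h z ∧ EE z)) ≤
      (allstr t).countP ((fun z => decide (consist h z ∧ EE z)) ∘ (· ++ [b])) := by
    intro b
    refine List.countP_mono_left ?_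
    intro z _ hz
    simp only [decide_eq_true_eq, Function.comp] at hz ⊢
    refine ⟨fun e he => ?_, EE_append b hz.2⟩
    have h1 := hz.1 e he
    have h2 : e.1 < z.length := by
      by_contra hh
      rw [List.getElem?_eq_none (by omega)] at h1; simp at h1
    rw [List.getElem?_append_left h2]; exact h1
  have := key false
  have := key true
  omega

theorem consist_count (h : Hist) (t : ℕ) (hn : (h.map (·.1)).Nodup) (hl : ∀ e ∈ h, e.1 < t) :
    ((SS t).filter (consist h)).card * 2 ^ h.length = 2 ^ t := by
  induction h with
  | nil =>
    have : (SS t).filter (consist []) = SS t := by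
      apply Finset.filter_true_of_mem; intro z _; simp [consist]
    rw [this, SS_card]; simp
  | cons e h ih =>
    obtain ⟨q, b, v⟩ := e
    simp only [List.map_cons, List.nodup_cons, List.forall_mem_cons] at hn hl
    have ih := ih hn.2 hl.2
    have key : ∀ b : Bool, ((SS t).filter (consist ((q, b, v) :: h))).card ≤
        ((SS t).filter (consist ((q, !b, v) :: h))).card := by
      intro b
      refine Finset.card_le_card_of_injOn (fun z => flip' z {q}) ?_ ?_
      · intro z hz
        simp only [Finset.coe_filter, Set.mem_ofPred_eq, mem_SS, consist, List.forall_mem_cons, flip_len, flip_get] at hz ⊢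
        obtain ⟨h1, h2, h3⟩ := hz
        refine ⟨h1, by simp [h2], fun e he => ?_⟩
        have : e.1 ≠ q := fun hh => hn.1 (hh ▸ List.mem_map_of_mem he)
        simp [h3 e he, this]
      · intro z _ z' _ heq
        simp only at heq
        rw [← flip'_flip' z {q}, heq, flip'_flip']
    have k1 := key b
    have k2 := key (!b)
    rw [Bool.not_not] at k2
    have hsum : ((SS t).filter (consist ((q, b, v) :: h))).card + ((SS t).filter (consist ((q, !b, v) :: h))).card = ((SS t).filter (consist h)).card := by
      rw [← Finset.card_union_of_disjoint]
      · congr 1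
        ext z
        simp only [consist, Finset.mem_union, Finset.mem_filter, List.forall_mem_cons, mem_SS]
        constructor
        · tauto
        · rintro ⟨h1, h2⟩
          have h3 : q < z.length := by omega
          rw [List.getElem?_eq_getElem h3]
          cases b <;> cases hz : z[q] <;> simp only [h1, h2, Bool.not_false, Bool.not_true, and_true, true_and, reduceCtorEq, or_true, or_false, false_or, false_and, and_false, true_or, Option.some.injEq] <;> exact h2
      · rw [Finset.disjoint_left]
        intro z h1 h2
        simp only [consist, Finset.mem_filter, List.forall_mem_cons] at h1 h2
        have := h1.2.1.symm.trans h2.2.1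
        simp at this
    rw [List.length_cons, pow_succ, ← ih, ← hsum]
    have : ((SS t).filter (consist ((q, b, v) :: h))).card = ((SS t).filter (consist ((q, !b, v) :: h))).card := le_antisymm k1 k2
    rw [← this]; ring


def colEv (h : Hist) (j : ℕ) : Hist := h.filter (fun e => e.1.unpair.1 = j)
def str (h : Hist) (j : ℕ) : List Bool := ((colEv h j).map (·.2.1)).reverse
def vl (h : Hist) (j : ℕ) : ℕ × ℕ := ((colEv h j).head?.map (·.2.2)).getD (1, 0)
def qv (v : ℕ × ℕ) : ℚ := v.1 / (v.2 + 1)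

theorem colEv_cons (e : Evt) (h : Hist) (j : ℕ) :
    colEv (e :: h) j = if e.1.unpair.1 = j then e :: colEv h j else colEv h j := by
  simp only [colEv, List.filter_cons]
  split_ifs <;> simp_all

theorem str_cons (e : Evt) (h : Hist) (j : ℕ) :
    str (e :: h) j = if e.1.unpair.1 = j then str h j ++ [e.2.1] else str h j := by
  simp only [str, colEv_cons]
  split_ifs <;> simp

theorem vl_cons (e : Evt) (h : Hist) (j : ℕ) :
    vl (e :: h) j = if e.1.unpair.1 = j then e.2.2 else vl h j := by
  simp only [vl, colEv_cons]
  split_ifs <;> simp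

theorem qv_nonneg (v : ℕ × ℕ) : 0 ≤ qv v := by unfold qv; positivity

noncomputable def NN (h : Hist) (t : ℕ) : ℚ := cnt h t * 2 ^ h.length / 2 ^ t
def Wq (s : ℕ) (h : Hist) : ℚ := ∑ j ∈ Finset.range s, qv (vl h j) / 2 ^ (j+2)

def Cond (s : ℕ) (h : Hist) : Prop := ∀ t, NN h t + Wq s h ≤ 1 - 1 / 2 ^ (s+1)

theorem NN_mono (h : Hist) {t t' : ℕ} (ht : t ≤ t') : NN h t ≤ NN h t' := by
  induction t', ht using Nat.le_induction with
  | base => exact le_rfl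
  | succ n hn ih =>
    refine le_trans ih ?_
    unfold NN
    have h1 : (2 * cnt h n : ℚ) ≤ cnt h (n+1) := by exact_mod_cast cnt_mono h n
    rw [div_le_div_iff₀ (by positivity) (by positivity)]
    have h2 : (0:ℚ) < 2 ^ h.length * 2 ^ n := by positivity
    rw [pow_succ]
    nlinarith

theorem NN_split (q : ℕ) (v v' : ℕ × ℕ) (h : Hist) (t : ℕ) :
    NN ((q, false, v) :: h) t + NN ((q, true, v') :: h) t ≤ 2 * NN h t := by
  have h1 : (cnt ((q, false, v) :: h) t + cnt ((q, true, v') :: h) t : ℚ) ≤ cnt h t := by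
    exact_mod_cast cnt_split q v v' h t
  unfold NN
  rw [← add_div, mul_div_assoc', div_le_div_iff_of_pos_right (by positivity)]
  simp only [List.length_cons, pow_succ]
  have h2 : (0:ℚ) < 2 ^ h.length := by positivity
  nlinarith

theorem Wq_cons (s : ℕ) (e : Evt) (h : Hist) (hj : e.1.unpair.1 < s) :
    Wq s (e :: h) = Wq s h + (qv e.2.2 - qv (vl h e.1.unpair.1)) / 2 ^ (e.1.unpair.1+2) := by
  have : ∀ j ∈ Finset.range s, qv (vl (e :: h) j) / 2 ^ (j+2) = qv (vl h j) / 2 ^ (j+2) +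
      if e.1.unpair.1 = j then (qv e.2.2 - qv (vl h e.1.unpair.1)) / 2 ^ (e.1.unpair.1+2) else 0 := by
    intro j _
    rw [vl_cons]
    split_ifs with h1
    · subst h1; ring
    · ring
  unfold Wq
  rw [Finset.sum_congr rfl this, Finset.sum_add_distrib]
  congr 1
  rw [Finset.sum_ite_eq, if_pos (Finset.mem_range.2 hj)]

/-! computability of Cond -/

def Wf' (h : Hist) (s : ℕ) : ℕ × ℕ :=
  s.rec (0, 1) (fun j p => (p.1 * ((vl h j).2 + 1) * 2 ^ (j+2) + (vl h j).1 * p.2,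
    p.2 * ((vl h j).2 + 1) * 2 ^ (j+2)))

theorem Wf'_spec (h : Hist) (s : ℕ) : 0 < (Wf' h s).2 ∧ Wq s h = (Wf' h s).1 / (Wf' h s).2 := by
  induction s with
  | zero => simp [Wf', Wq]
  | succ s ih =>
    have e : Wf' h (s+1) = ((Wf' h s).1 * ((vl h s).2 + 1) * 2 ^ (s+2) + (vl h s).1 * (Wf' h s).2,
      (Wf' h s).2 * ((vl h s).2 + 1) * 2 ^ (s+2)) := rfl
    rw [e]
    obtain ⟨h1, h2⟩ := ih
    refine ⟨by positivity, ?_⟩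
    rw [Wq, Finset.sum_range_succ, ← Wq, h2, qv]
    have : (0:ℚ) < (Wf' h s).2 := by exact_mod_cast h1
    push_cast
    field_simp

def Ctest (s : ℕ) (h : Hist) (t : ℕ) (c : ℕ) : Prop :=
  c * 2 ^ h.length * (Wf' h s).2 * 2 ^ (s+1) + (Wf' h s).1 * 2 ^ t * 2 ^ (s+1) + 2 ^ t * (Wf' h s).2
    ≤ (Wf' h s).2 * 2 ^ t * 2 ^ (s+1)

theorem Cond_iff (s : ℕ) (h : Hist) : Cond s h ↔ ∀ t, Ctest s h t (cnt h t) := by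
  unfold Cond
  refine forall_congr' (fun t => ?_)
  obtain ⟨h1, h2⟩ := Wf'_spec h s
  have h3 : (0:ℚ) < (Wf' h s).2 := by exact_mod_cast h1
  unfold Ctest NN
  rw [h2]
  rw [← @Nat.cast_le ℚ]
  push_cast
  have h4 : (0:ℚ) < (Wf' h s).2 * 2 ^ t * 2 ^ (s+1) := by positivity
  have e1 : ((cnt h t : ℚ) * 2 ^ h.length / 2 ^ t + (Wf' h s).1 / (Wf' h s).2) =
    ((cnt h t : ℚ) * 2 ^ h.length * (Wf' h s).2 * 2 ^ (s+1) + (Wf' h s).1 * 2 ^ t * 2 ^ (s+1)) / ((Wf' h s).2 * 2 ^ t * 2 ^ (s+1)) := by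
    field_simp
  have e2 : (1 - 1 / 2 ^ (s+1) : ℚ) = ((Wf' h s).2 * 2 ^ t * 2 ^ (s+1) - 2 ^ t * (Wf' h s).2) / ((Wf' h s).2 * 2 ^ t * 2 ^ (s+1)) := by
    field_simp
  rw [e1, e2, div_le_div_iff_of_pos_right h4]
  constructor <;> intro hh <;> linarith

section prim
variable {α β : Type} [Primcodable α] [Primcodable β]

theorem pr_pow2 {f : α → ℕ} (hf : Primrec f) : Primrec (fun a => 2 ^ f a) := by
  have h : Primrec (fun n : ℕ => 2 ^ n) := by
    refine (Primrec.nat_rec₁ (f := fun _ (i : ℕ) => 2 * i) 1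
      (Primrec.nat_mul.comp (Primrec.const 2) Primrec.snd)).of_eq ?_
    intro n
    induction n with
    | zero => rfl
    | succ n ih => simp only [ih]; ring
  exact h.comp hf

theorem pr_add {f g : α → ℕ} (hf : Primrec f) (hg : Primrec g) : Primrec (fun a => f a + g a) :=
  Primrec.nat_add.comp hf hg
theorem pr_mul {f g : α → ℕ} (hf : Primrec f) (hg : Primrec g) : Primrec (fun a => f a * g a) :=
  Primrec.nat_mul.comp hf hg
theorem pr_addc {f : α → ℕ} (hf : Primrec f) (c : ℕ) : Primrec (fun a => f a + c) :=
  Primrec.nat_add.comp hf (Primrec.const c)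

theorem pr_filter {L : α → List β} {p : α → β → Prop} (hL : Primrec L)
    (hp : PrimrecPred (fun q : α × β => p q.1 q.2)) :
    Primrec (fun a => (L a).filter (fun b => decide (p a b))) := by
  have h : Primrec (fun a => (L a).filterMap (fun b => if p a b then some b else none)) :=
    Primrec.listFilterMap hL (Primrec.ite hp (Primrec.option_some.comp Primrec.snd) (Primrec.const none))
  refine h.of_eq ?_
  intro a
  rw [← List.filterMap_eq_filter]
  congr 1
  funext b
  simp [Option.guard]
end prim

theorem colEv_pr : Primrec (fun p : Hist × ℕ => colEv p.1 p.2) := by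
  have hp : PrimrecPred (fun q : (Hist × ℕ) × Evt => q.2.1.unpair.1 = q.1.2) :=
    pr_eq (pr_un1 (Primrec.fst.comp Primrec.snd)) (Primrec.snd.comp Primrec.fst)
  exact (pr_filter (p := fun (a : Hist × ℕ) (e : Evt) => e.1.unpair.1 = a.2) Primrec.fst hp).of_eq
    (by intro a; exact List.filter_congr (fun b _ => decide_eq_decide.2 Iff.rfl))

theorem str_pr : Primrec (fun p : Hist × ℕ => str p.1 p.2) :=
  Primrec.list_reverse.comp (Primrec.list_map colEv_pr (Primrec.fst.comp (Primrec.snd.comp Primrec.snd)))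

theorem vl_pr : Primrec (fun p : Hist × ℕ => vl p.1 p.2) := by
  refine Primrec.option_getD.comp (Primrec.option_map (Primrec.list_head?.comp colEv_pr) ?_) (Primrec.const _)
  exact Primrec.snd.comp (Primrec.snd.comp Primrec.snd)

theorem Wf'_pr : Primrec (fun p : Hist × ℕ => Wf' p.1 p.2) := by
  refine Primrec.nat_rec (f := fun _ : Hist => ((0, 1) : ℕ × ℕ))
    (g := fun h q => (q.2.1 * ((vl h q.1).2 + 1) * 2 ^ (q.1+2) + (vl h q.1).1 * q.2.2,
    q.2.2 * ((vl h q.1).2 + 1) * 2 ^ (q.1+2))) (Primrec.const _) ?_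
  have hv : Primrec (fun p : Hist × ℕ × (ℕ × ℕ) => vl p.1 p.2.1) :=
    vl_pr.comp (Primrec.pair Primrec.fst (Primrec.fst.comp Primrec.snd))
  have hj : Primrec (fun p : Hist × ℕ × (ℕ × ℕ) => 2 ^ (p.2.1 + 2)) :=
    pr_pow2 (pr_addc (Primrec.fst.comp Primrec.snd) 2)
  have h1 : Primrec (fun p : Hist × ℕ × (ℕ × ℕ) => p.2.2.1) := (Primrec.fst.comp (Primrec.snd.comp Primrec.snd))
  have h2 : Primrec (fun p : Hist × ℕ × (ℕ × ℕ) => p.2.2.2) := (Primrec.snd.comp (Primrec.snd.comp Primrec.snd))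
  have hv1 : Primrec (fun p : Hist × ℕ × (ℕ × ℕ) => (vl p.1 p.2.1).1) := Primrec.fst.comp hv
  have hv2 : Primrec (fun p : Hist × ℕ × (ℕ × ℕ) => (vl p.1 p.2.1).2 + 1) := pr_addc (Primrec.snd.comp hv) 1
  exact Primrec.pair (pr_add (pr_mul (pr_mul h1 hv2) hj) (pr_mul hv1 h2)) (pr_mul (pr_mul h2 hv2) hj)

theorem consist_pr : PrimrecPred (fun p : Hist × List Bool => consist p.1 p.2) := by
  refine pr_forall Primrec.fst ?_
  exact pr_eq (pr_get (Primrec.snd.comp Primrec.fst) (Primrec.fst.comp Primrec.snd))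
    (Primrec.option_some.comp (Primrec.fst.comp (Primrec.snd.comp Primrec.snd)))

theorem cnt_pr : Primrec (fun p : Hist × ℕ => cnt p.1 p.2) := by
  have hp : PrimrecPred (fun q : (Hist × ℕ) × List Bool => consist q.1.1 q.2 ∧ EE q.2) :=
    (consist_pr.comp (Primrec.pair (Primrec.fst.comp Primrec.fst) Primrec.snd)).and (EE_pr.comp Primrec.snd)
  refine (Primrec.list_length.comp (pr_filter (p := fun (a : Hist × ℕ) z => consist a.1 z ∧ EE z)
    (allstr_pr.comp Primrec.snd) hp)).of_eq ?_
  intro a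
  rw [cnt, List.countP_eq_length_filter]
  congr 1
  exact List.filter_congr (fun b _ => decide_eq_decide.2 Iff.rfl)

theorem Ctest_pr_aux {α : Type} [Primcodable α] {c l w2 s w1 t : α → ℕ} (hc : Primrec c) (hl : Primrec l)
    (hW2 : Primrec w2) (hs : Primrec s) (hW1 : Primrec w1) (ht : Primrec t) :
    PrimrecPred (fun p => c p * l p * w2 p * s p + w1 p * t p * s p + t p * w2 p ≤ w2 p * t p * s p) :=
  pr_le (pr_add (pr_add (pr_mul (pr_mul (pr_mul hc hl) hW2) hs) (pr_mul (pr_mul hW1 ht) hs)) (pr_mul ht hW2))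
    (pr_mul (pr_mul hW2 ht) hs)

theorem Ctest_pr : PrimrecPred (fun p : (ℕ × Hist) × ℕ => Ctest p.1.1 p.1.2 p.2 (cnt p.1.2 p.2)) := by
  have hh : Primrec (fun p : (ℕ × Hist) × ℕ => p.1.2) := Primrec.snd.comp Primrec.fst
  have h1 : Primrec (fun p : (ℕ × Hist) × ℕ => p.1.1+1) := pr_addc (Primrec.fst.comp Primrec.fst) 1
  have hl : Primrec (fun p : (ℕ × Hist) × ℕ => p.1.2.length) := (Primrec.list_length.comp hh)
  have hc : Primrec (fun p : (ℕ × Hist) × ℕ => cnt p.1.2 p.2) := cnt_pr.comp (Primrec.pair hh Primrec.snd)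
  have hp : Primrec (fun p : (ℕ × Hist) × ℕ => (p.1.2, p.1.1)) :=
    Primrec.pair hh (Primrec.fst.comp Primrec.fst)
  have hW := Wf'_pr.comp hp
  have hh2 := Ctest_pr_aux hc (pr_pow2 hl) (Primrec.snd.comp hW) (pr_pow2 h1) (Primrec.fst.comp hW) (pr_pow2 Primrec.snd)
  exact hh2.of_eq (fun p => Iff.rfl)

theorem Cond_CI : CI K (fun p : ℕ × Hist => decide (Cond p.1 p.2)) := by
  have h1 : CI (jump ∅) (fun p : ℕ × Hist => decide (∃ t, decide (¬ Ctest p.1 p.2 t (cnt p.2 t)) = true)) :=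
    CI_ex (R := fun q : (ℕ × Hist) × ℕ => decide (¬ Ctest q.1.1 q.1.2 q.2 (cnt q.1.2 q.2)))
      (CI.of_primrec Ctest_pr.not.decide)
  have h2 := CI.cond h1 (CI.of_primrec (Primrec.const false)) (CI.of_primrec (Primrec.const true))
  refine h2.of_eq ?_
  intro p
  have : Cond p.1 p.2 ↔ ¬ (∃ t, decide (¬ Ctest p.1 p.2 t (cnt p.2 t)) = true) := by
    rw [Cond_iff]; simp
  by_cases hc : ∃ t, decide (¬ Ctest p.1 p.2 t (cnt p.2 t)) = true
  · have h3 : ¬ Cond p.1 p.2 := fun h => this.1 h hc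
    rw [decide_eq_true hc, decide_eq_false h3]; rfl
  · have h3 : Cond p.1 p.2 := this.2 hc
    rw [decide_eq_false hc, decide_eq_true h3]; rfl


def le2 (v0 v1 v : ℕ × ℕ) : Prop :=
  (v0.1 * (v1.2+1) + v1.1 * (v0.2+1)) * (v.2+1) ≤ 2 * v.1 * (v0.2+1) * (v1.2+1)

theorem le2_iff (v0 v1 v : ℕ × ℕ) : le2 v0 v1 v ↔ qv v0 + qv v1 ≤ 2 * qv v := by
  unfold le2 qv
  rw [div_add_div _ _ (by positivity) (by positivity), mul_div_assoc', div_le_div_iff₀ (by positivity) (by positivity)]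
  rw [← @Nat.cast_le ℚ]
  push_cast
  constructor <;> intro h <;> linarith

/-- candidate extension pair; `p = (s, h, τ)` -/
noncomputable def cand (s : ℕ) (h : Hist) (τ : List Bool) : Option (Hist × Hist) :=
  (ev s.unpair.2.unpair.2 s.unpair.1 τ (encode (str h s.unpair.1 ++ [false]))).elim none (fun v0 =>
    (ev s.unpair.2.unpair.2 s.unpair.1 τ (encode (str h s.unpair.1 ++ [true]))).elim none (fun v1 =>
      if le2 v0.unpair v1.unpair (vl h s.unpair.1) then
        some ((Nat.pair s.unpair.1 (str h s.unpair.1).length, false, v0.unpair) :: h,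
          (Nat.pair s.unpair.1 (str h s.unpair.1).length, true, v1.unpair) :: h)
      else none))

theorem le2_pr_aux {α : Type} [Primcodable α] {v0 v1 v : α → ℕ × ℕ} (h0 : Primrec v0) (h1 : Primrec v1)
    (h : Primrec v) : PrimrecPred (fun a => le2 (v0 a) (v1 a) (v a)) := by
  have a0 := Primrec.fst.comp h0
  have b0 := pr_addc (Primrec.snd.comp h0) 1
  have a1 := Primrec.fst.comp h1
  have b1 := pr_addc (Primrec.snd.comp h1) 1
  have a := Primrec.fst.comp h
  have b := pr_addc (Primrec.snd.comp h) 1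
  exact pr_le (pr_mul (pr_add (pr_mul a0 b1) (pr_mul a1 b0)) b)
    (pr_mul (pr_mul (pr_mul (Primrec.const 2) a) b0) b1)

theorem cand_pr : Primrec (fun p : ℕ × Hist × List Bool => cand p.1 p.2.1 p.2.2) := by
  have hj : Primrec (fun p : ℕ × Hist × List Bool => p.1.unpair.1) := pr_un1 Primrec.fst
  have hk : Primrec (fun p : ℕ × Hist × List Bool => p.1.unpair.2.unpair.2) := pr_un2 (pr_un2 Primrec.fst)
  have hh : Primrec (fun p : ℕ × Hist × List Bool => p.2.1) := Primrec.fst.comp Primrec.snd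
  have ht : Primrec (fun p : ℕ × Hist × List Bool => p.2.2) := Primrec.snd.comp Primrec.snd
  have hhj : Primrec (fun p : ℕ × Hist × List Bool => (p.2.1, p.1.unpair.1)) := Primrec.pair hh hj
  have hx : Primrec (fun p : ℕ × Hist × List Bool => str p.2.1 p.1.unpair.1) := str_pr.comp hhj
  have hv : Primrec (fun p : ℕ × Hist × List Bool => vl p.2.1 p.1.unpair.1) := vl_pr.comp hhj
  have he : ∀ b, Primrec (fun p : ℕ × Hist × List Bool =>
      ev p.1.unpair.2.unpair.2 p.1.unpair.1 p.2.2 (encode (str p.2.1 p.1.unpair.1 ++ [b]))) := by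
    intro b
    have h1 : Primrec (fun p : ℕ × Hist × List Bool => encode (str p.2.1 p.1.unpair.1 ++ [b])) :=
      Primrec.encode.comp (Primrec.list_append.comp hx (Primrec.const [b]))
    exact ev_primrec.comp (Primrec.pair hk (Primrec.pair hj (Primrec.pair ht h1)))
  have hpos : Primrec (fun p : ℕ × Hist × List Bool => Nat.pair p.1.unpair.1 (str p.2.1 p.1.unpair.1).length) :=
    Primrec₂.natPair.comp hj (Primrec.list_length.comp hx)
  refine pr_elim (he false) (Primrec.const none) ?_
  refine pr_elim ((he true).comp Primrec.fst) (Primrec.const none) ?_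
  have f1 : Primrec (fun q : ((ℕ × Hist × List Bool) × ℕ) × ℕ => q.1.1) := Primrec.fst.comp Primrec.fst
  have u0 : Primrec (fun q : ((ℕ × Hist × List Bool) × ℕ) × ℕ => q.1.2.unpair) :=
    Primrec.unpair.comp (Primrec.snd.comp Primrec.fst)
  have u1 : Primrec (fun q : ((ℕ × Hist × List Bool) × ℕ) × ℕ => q.2.unpair) :=
    Primrec.unpair.comp Primrec.snd
  refine Primrec.ite (le2_pr_aux u0 u1 (hv.comp f1)) (Primrec.option_some.comp (Primrec.pair ?_ ?_)) (Primrec.const none)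
  · exact Primrec.list_cons.comp (Primrec.pair (hpos.comp f1) (Primrec.pair (Primrec.const false) u0)) (hh.comp f1)
  · exact Primrec.list_cons.comp (Primrec.pair (hpos.comp f1) (Primrec.pair (Primrec.const true) u1)) (hh.comp f1)

noncomputable def step (s : ℕ) (h : Hist) : Hist :=
  (cand s h (seg K s.unpair.2.unpair.1)).elim h (fun c => bif decide (Cond (s+1) c.1) then c.1 else c.2)

noncomputable def st (s : ℕ) : Hist := s.rec [] (fun s h => step s h)

theorem st_succ (s : ℕ) : st (s+1) = step s (st s) := rfl

theorem step_CI : CI K (fun p : ℕ × Hist => step p.1 p.2) := by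
  have hseg : CI K (fun p : ℕ × Hist => seg K p.1.unpair.2.unpair.1) :=
    CI.comp (g := fun m => seg K m) CI_seg (CI.of_primrec (pr_un1 (pr_un2 Primrec.fst)))
  have h1 : CI K (fun p : ℕ × Hist => (p.1, p.2, seg K p.1.unpair.2.unpair.1)) :=
    CI.pair (CI.of_primrec Primrec.fst) (CI.pair (CI.of_primrec Primrec.snd) hseg)
  have h2 := CI.comp (CI.of_primrec (A := K) cand_pr) h1
  have h3 : CI K (fun q : (ℕ × Hist) × (Hist × Hist) => decide (Cond (q.1.1+1) q.2.1)) := by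
    have h4 : Primrec (fun q : (ℕ × Hist) × (Hist × Hist) => (q.1.1+1, q.2.1)) :=
      Primrec.pair (pr_addc (Primrec.fst.comp Primrec.fst) 1) (Primrec.fst.comp Primrec.snd)
    have h5 := CI.comp Cond_CI (CI.of_primrec (A := K) h4)
    exact h5
  have h5 : CI K (fun q : (ℕ × Hist) × (Hist × Hist) => bif decide (Cond (q.1.1+1) q.2.1) then q.2.1 else q.2.2) :=
    CI.cond h3 (CI.of_primrec (Primrec.fst.comp Primrec.snd)) (CI.of_primrec (Primrec.snd.comp Primrec.snd))
  have h6 := CI_opt h5 h2 (CI.of_primrec Primrec.snd)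
  exact h6

theorem st_CI : CI K st := by
  have h : CI K (fun q : Unit × ℕ × Hist => step q.2.1 q.2.2) :=
    CI.comp step_CI (CI.of_primrec Primrec.snd)
  have h1 := CI.nat_rec (f := fun _ : Unit => ([] : Hist)) (g := fun q : Unit × ℕ × Hist => step q.2.1 q.2.2)
    (CI.of_primrec (Primrec.const [])) h
  have h2 : Primrec (fun n : ℕ => (((), n) : Unit × ℕ)) := Primrec.pair (Primrec.const _) Primrec.id
  have h3 := CI.comp h1 (CI.of_primrec (A := K) h2)
  exact h3


theorem st_cases (s : ℕ) : st (s+1) = st s ∨ ∃ v0 v1 b,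
    ev s.unpair.2.unpair.2 s.unpair.1 (seg K s.unpair.2.unpair.1) (encode (str (st s) s.unpair.1 ++ [false])) = some v0 ∧
    ev s.unpair.2.unpair.2 s.unpair.1 (seg K s.unpair.2.unpair.1) (encode (str (st s) s.unpair.1 ++ [true])) = some v1 ∧
    le2 v0.unpair v1.unpair (vl (st s) s.unpair.1) ∧
    st (s+1) = (Nat.pair s.unpair.1 (str (st s) s.unpair.1).length, b, (if b = true then v1 else v0).unpair) :: st s ∧
    (b = false → Cond (s+1) (st (s+1))) ∧
    (b = true → ¬ Cond (s+1) ((Nat.pair s.unpair.1 (str (st s) s.unpair.1).length, false, v0.unpair) :: st s)) := by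
  rw [st_succ, step, cand]
  rcases h0 : ev s.unpair.2.unpair.2 s.unpair.1 (seg K s.unpair.2.unpair.1)
    (encode (str (st s) s.unpair.1 ++ [false])) with _ | v0
  · left; rfl
  rcases h1 : ev s.unpair.2.unpair.2 s.unpair.1 (seg K s.unpair.2.unpair.1)
    (encode (str (st s) s.unpair.1 ++ [true])) with _ | v1
  · left; rfl
  simp only [Option.elim_some]
  by_cases hl : le2 v0.unpair v1.unpair (vl (st s) s.unpair.1)
  · right
    simp only [if_pos hl, Option.elim_some]
    by_cases hc : Cond (s+1) ((Nat.pair s.unpair.1 (str (st s) s.unpair.1).length, false, v0.unpair) :: st s)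
    · refine ⟨v0, v1, false, rfl, rfl, hl, ?_, ?_, ?_⟩ <;> simp [hc]
    · refine ⟨v0, v1, true, rfl, rfl, hl, ?_, ?_, ?_⟩ <;> simp [hc]
  · left
    simp only [if_neg hl, Option.elim_none]

/-- what happens if both evaluations converge and the test passes -/
theorem st_grow (s v0 v1 : ℕ) 
    (h0 : ev s.unpair.2.unpair.2 s.unpair.1 (seg K s.unpair.2.unpair.1) (encode (str (st s) s.unpair.1 ++ [false])) = some v0)
    (h1 : ev s.unpair.2.unpair.2 s.unpair.1 (seg K s.unpair.2.unpair.1) (encode (str (st s) s.unpair.1 ++ [true])) = some v1)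
    (hl : le2 v0.unpair v1.unpair (vl (st s) s.unpair.1)) :
    (str (st (s+1)) s.unpair.1).length = (str (st s) s.unpair.1).length + 1 := by
  rw [st_succ, step, cand, h0, h1]
  simp only [Option.elim_some, if_pos hl]
  cases decide (Cond (s+1) ((Nat.pair s.unpair.1 (str (st s) s.unpair.1).length, false, v0.unpair) :: st s)) <;>
    simp [str_cons]

def Wf : Hist → Prop
  | [] => True
  | e :: h => e.1.unpair.2 = (str h e.1.unpair.1).length ∧ Wf h

theorem Wf_mem {h : Hist} (hw : Wf h) (j x : ℕ) (b : Bool) :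
    (str h j)[x]? = some b ↔ ∃ v, (Nat.pair j x, b, v) ∈ h := by
  induction h with
  | nil => simp [str, colEv]
  | cons e h ih =>
    obtain ⟨q, c, v⟩ := e
    obtain ⟨h1, h2⟩ := hw
    have ih := ih h2
    dsimp only at h1
    have hq : Nat.pair q.unpair.1 q.unpair.2 = q := Nat.pair_unpair q
    rw [str_cons]
    simp only [List.mem_cons, Prod.mk.injEq]
    split_ifs with hj
    · subst hj
      rw [List.getElem?_append]
      split_ifs with hx
      · rw [ih]
        have : ¬ Nat.pair q.unpair.1 x = q := by
          intro e
          rw [← e] at h1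
          simp at h1
          rw [← e] at hx
          simp at hx
          omega
        simp [this]
      · have hn : ¬ ∃ v, (Nat.pair q.unpair.1 x, b, v) ∈ h := by
          rw [← ih]
          rw [List.getElem?_eq_none (by omega)]; simp
        push Not at hn
        by_cases hx' : x = (str h q.unpair.1).length
        · subst hx'
          rw [← h1, hq]
          simp
          constructor
          · rintro rfl; exact ⟨v.1, v.2, Or.inl ⟨rfl, rfl⟩⟩
          · rintro ⟨a, b', h | h⟩
            · exact h.1.symm
            · exfalso; apply hn (a, b'); rw [← h1, hq]; exact h
        · have : ¬ Nat.pair q.unpair.1 x = q := by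
            intro e
            have := congrArg (fun y => y.unpair.2) e
            simp at this
            omega
          simp only [this, hn, false_and, or_self, exists_false, iff_false]
          rw [List.getElem?_eq_none (by simp; omega)]
          simp
    · rw [ih]
      have : ¬ Nat.pair j x = q := by
        intro e; apply hj; rw [← e]; simp
      simp [this]

theorem Wf_nodup {h : Hist} (hw : Wf h) : (h.map (·.1)).Nodup := by
  induction h with
  | nil => simp
  | cons e h ih =>
    obtain ⟨h1, h2⟩ := hw
    rw [List.map_cons, List.nodup_cons]
    refine ⟨?_, ih h2⟩
    intro hm
    obtain ⟨e', he', heq⟩ := List.mem_map.1 hm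
    have : (str h e.1.unpair.1)[e.1.unpair.2]? = some e'.2.1 := by
      rw [Wf_mem h2]
      refine ⟨e'.2.2, ?_⟩
      rw [Nat.pair_unpair, ← heq]
      exact he'
    rw [h1] at this
    simp at this

theorem st_Wf (s : ℕ) : Wf (st s) := by
  induction s with
  | zero => exact trivial
  | succ s ih =>
    rcases st_cases s with h | ⟨v0, v1, b, -, -, -, h, -, -⟩
    · rw [h]; exact ih
    · rw [h]; exact ⟨by simp, ih⟩

theorem st_empty (s j : ℕ) (hj : s ≤ j) : colEv (st s) j = [] := by
  induction s with
  | zero => rfl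
  | succ s ih =>
    rcases st_cases s with h | ⟨v0, v1, b, -, -, -, h, -, -⟩
    · rw [h]; exact ih (by omega)
    · rw [h, colEv_cons, if_neg, ih (by omega)]
      simp only [Nat.unpair_pair]
      have := Nat.unpair_left_le s
      omega

theorem Cond_up {s : ℕ} {h : Hist} (hv : vl h s = (1, 0)) (hc : Cond s h) (t : ℕ) :
    NN h t + Wq (s+1) h ≤ 1 - 1 / 2 ^ (s+2) := by
  have := hc t
  rw [Wq, Finset.sum_range_succ, ← Wq, hv]
  have e : qv (1, 0) = 1 := by simp [qv]
  rw [e]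
  have : (1 : ℚ) / 2 ^ (s+1) = 2 * (1 / 2 ^ (s+2)) := by rw [pow_succ 2 (s+1)]; field_simp
  linarith

theorem st_Cond (s : ℕ) : Cond s (st s) := by
  induction s with
  | zero =>
    intro t
    have := cnt_nil t
    simp only [NN, st, Wq]
    simp
    norm_num at this ⊢
    linarith
  | succ s ih =>
    have hv : vl (st s) s = (1, 0) := by rw [vl, st_empty s s le_rfl]; rfl
    have hup := Cond_up hv ih
    rcases st_cases s with h | ⟨v0, v1, b, -, -, hl, h, hb, hb'⟩
    · rw [h]; exact hup
    cases b with
    | false => exact hb rfl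
    | true =>
      have hb' := hb' rfl
      rw [h]
      set q := Nat.pair s.unpair.1 (str (st s) s.unpair.1).length with hq
      have hq1 : q.unpair.1 = s.unpair.1 := by simp [hq]
      have hlt : s.unpair.1 < s + 1 := by have := Nat.unpair_left_le s; omega
      unfold Cond at hb'
      push Not at hb'
      obtain ⟨t0, ht0⟩ := hb'
      intro t
      have m1 := NN_mono ((q, false, v0.unpair) :: st s) (le_max_left t0 t)
      have m2 := NN_mono ((q, true, v1.unpair) :: st s) (le_max_right t0 t)
      have m3 := NN_split q v0.unpair v1.unpair (st s) (max t0 t)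
      have m4 := hup (max t0 t)
      rw [Wq_cons _ _ _ (by simpa [hq1] using hlt)] at ht0 ⊢
      simp only [hq1] at ht0 ⊢
      simp only [if_true]
      rw [le2_iff] at hl
      have hpos : (0:ℚ) < 1 / 2 ^ (s.unpair.1 + 2) := by positivity
      have m5 : (qv v0.unpair - qv (vl (st s) s.unpair.1)) / 2 ^ (s.unpair.1 + 2) +
        (qv v1.unpair - qv (vl (st s) s.unpair.1)) / 2 ^ (s.unpair.1 + 2) ≤ 0 := by
        rw [← add_div]
        apply div_nonpos_of_nonpos_of_nonneg
        · linarith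
        · positivity
      linarith

theorem str_mono_succ (s j : ℕ) : str (st s) j <+: str (st (s+1)) j := by
  rcases st_cases s with h | ⟨v0, v1, b, -, -, -, h, -, -⟩
  · rw [h]
  · rw [h, str_cons]
    split_ifs <;> first | exact List.prefix_append _ _ | exact List.prefix_rfl

theorem str_mono {s t : ℕ} (h : s ≤ t) (j : ℕ) : str (st s) j <+: str (st t) j := by
  induction t, h using Nat.le_induction with
  | base => exact List.prefix_rfl
  | succ n _ ih => exact ih.trans (str_mono_succ n j)

theorem str_len_succ (s j : ℕ) : (str (st (s+1)) j).length ≤ (str (st s) j).length + 1 := by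
  rcases st_cases s with h | ⟨v0, v1, b, -, -, -, h, -, -⟩
  · rw [h]; omega
  · rw [h, str_cons]
    split_ifs <;> simp

theorem vl_bound (s j : ℕ) : qv (vl (st s) j) ≤ 2 ^ (j+2) := by
  by_cases hj : j < s
  · have h := st_Cond s 0
    have h1 : 0 ≤ NN (st s) 0 := by unfold NN; positivity
    have h2 : qv (vl (st s) j) / 2 ^ (j+2) ≤ Wq s (st s) := by
      unfold Wq
      exact Finset.single_le_sum (f := fun j => qv (vl (st s) j) / 2 ^ (j+2))
        (fun i _ => div_nonneg (qv_nonneg _) (by positivity)) (Finset.mem_range.2 hj)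
    have h3 : (0:ℚ) ≤ 1 / 2 ^ (s+1) := by positivity
    have h4 : qv (vl (st s) j) / 2 ^ (j+2) ≤ 1 := by linarith
    rwa [div_le_one (by positivity)] at h4
  · rw [vl, st_empty s j (by omega)]
    have : (1:ℚ) ≤ 2 ^ (j+2) := one_le_pow₀ (by norm_num)
    simpa [qv] using this

theorem no_all_EE (s t : ℕ) (ht : ∀ e ∈ st s, e.1 < t) : ∃ z : List Bool, z.length = t ∧ consist (st s) z ∧ ¬ EE z := by
  by_contra hcon
  push Not at hcon
  have h1 : cnt (st s) t = ((SS t).filter (fun z => consist (st s) z)).card := by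
    rw [cnt_eq]
    congr 1
    apply Finset.filter_congr
    intro z hz
    have := hcon z (mem_SS.1 hz)
    tauto
  have h2 := consist_count (st s) t (Wf_nodup (st_Wf s)) ht
  have h3 : NN (st s) t = 1 := by
    unfold NN
    rw [h1]
    rw [div_eq_one_iff_eq (by positivity)]
    exact_mod_cast h2
  have h4 := st_Cond s t
  have h5 : 0 ≤ Wq s (st s) := Finset.sum_nonneg (fun i _ => div_nonneg (qv_nonneg _) (by positivity))
  have h6 : (0:ℚ) < 1 / 2 ^ (s+1) := by positivity
  linarith


def Pos (q : ℕ) (b : Bool) : Prop := ∃ s, (str (st s) q.unpair.1)[q.unpair.2]? = some b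
def ColSet (j : ℕ) : Set ℕ := {x | Pos (Nat.pair j x) true}
def TotCol (j : ℕ) : Prop := ∀ n, ∃ s, n < (str (st s) j).length

theorem pre_get {l l' : List Bool} (h : l <+: l') {x : ℕ} {b : Bool} (hx : l[x]? = some b) : l'[x]? = some b := by
  obtain ⟨r, rfl⟩ := h
  have : x < l.length := by
    by_contra hc
    rw [List.getElem?_eq_none (by omega)] at hx; simp at hx
  rw [List.getElem?_append_left this]; exact hx

theorem st_get_mono {s t : ℕ} (h : s ≤ t) {j x : ℕ} {b : Bool} (hx : (str (st s) j)[x]? = some b) :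
    (str (st t) j)[x]? = some b := pre_get (str_mono h j) hx

theorem st_get_unique {s t j x : ℕ} {b b' : Bool} (h : (str (st s) j)[x]? = some b)
    (h' : (str (st t) j)[x]? = some b') : b = b' := by
  have h1 := st_get_mono (le_max_left s t) h
  have h2 := st_get_mono (le_max_right s t) h'
  rw [h1] at h2; exact Option.some.inj h2

theorem st_get_true {s j x : ℕ} {b : Bool} (h : (str (st s) j)[x]? = some b) : (x ∈ ColSet j ↔ b = true) := by
  constructor
  · rintro ⟨t, ht⟩
    simp only [Nat.unpair_pair] at ht
    exact st_get_unique h ht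
  · rintro rfl
    exact ⟨s, by simpa using h⟩

theorem str_seg (s j : ℕ) : str (st s) j = seg (ColSet j) (str (st s) j).length := by
  apply List.ext_getElem?
  intro i
  by_cases hi : i < (str (st s) j).length
  · rw [seg_get _ _ _ hi]
    have h1 : (str (st s) j)[i]? = some (str (st s) j)[i] := List.getElem?_eq_getElem hi
    rw [h1]
    congr 1
    have := st_get_true h1
    cases hb : (str (st s) j)[i]
    · rw [hb] at this; simp [this]
    · rw [hb] at this; simp [this]
  · rw [List.getElem?_eq_none (by omega), List.getElem?_eq_none (by rw [seg_length]; omega)]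

theorem strst_CI (j : ℕ) : CI K (fun s => str (st s) j) := by
  have h1 : Primrec (fun h : Hist => (h, j)) := Primrec.pair Primrec.id (Primrec.const j)
  have h2 : Primrec (fun h : Hist => str h j) := str_pr.comp h1
  exact CI.comp (g := fun h : Hist => str h j) (CI.of_primrec h2) st_CI

theorem col_CI {j : ℕ} (hj : TotCol j) : CI K (fun x => decide (x ∈ ColSet j)) := by
  have h1 : CI K (fun p : ℕ × ℕ => decide (p.1 < (str (st p.2) j).length)) := by
    have h2 : CI K (fun p : ℕ × ℕ => (p.1, str (st p.2) j)) :=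
      CI.pair (CI.of_primrec Primrec.fst) (CI.comp (g := fun s => str (st s) j) (strst_CI j) (CI.of_primrec Primrec.snd))
    have h3 : Primrec (fun q : ℕ × List Bool => decide (q.1 < q.2.length)) :=
      (pr_lt Primrec.fst (Primrec.list_length.comp Primrec.snd)).decide
    have h4 := CI.comp (CI.of_primrec (A := K) h3) h2
    exact h4
  have h2 : ∀ a, ∃ y, (fun p : ℕ × ℕ => decide (p.1 < (str (st p.2) j).length)) (a, y) = true := by
    intro a; obtain ⟨s, hs⟩ := hj a; exact ⟨s, by simpa using hs⟩
  obtain ⟨F, h3, hF⟩ : ∃ F : ℕ → ℕ, CI K F ∧ ∀ a, a < (str (st (F a)) j).length :=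
    ⟨_, CI_find h1 h2, fun a => by have := Nat.find_spec (h2 a); simpa using this⟩
  have h4 : CI K (fun a => (a, str (st (F a)) j)) :=
    CI.pair (CI.of_primrec Primrec.id) (CI.comp (g := fun s => str (st s) j) (strst_CI j) h3)
  have h5 : Primrec (fun q : ℕ × List Bool => decide (q.2[q.1]? = some true)) :=
    (pr_eqc (pr_get Primrec.snd Primrec.fst) _).decide
  have h6 := CI.comp (CI.of_primrec (A := K) h5) h4
  refine h6.of_eq ?_
  intro a
  obtain ⟨b, hb⟩ : ∃ b, (str (st (F a)) j)[a]? = some b := ⟨_, List.getElem?_eq_getElem (hF a)⟩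
  simp only
  rw [hb]
  have := st_get_true hb
  cases b <;> simp [this]

theorem vl_sound {j : ℕ} {f : ℕ → ℕ} (hs : ∀ m k x v, ev k j (seg K m) x = some v → v = f x) (s : ℕ) :
    (str (st s) j = [] ∧ vl (st s) j = (1, 0)) ∨ vl (st s) j = (f (encode (str (st s) j))).unpair := by
  induction s with
  | zero => left; exact ⟨rfl, rfl⟩
  | succ s ih =>
    rcases st_cases s with h | ⟨v0, v1, b, h0, h1, -, h, -, -⟩
    · rw [h]; exact ih
    · rw [h, str_cons, vl_cons]
      by_cases hj : s.unpair.1 = j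
      · subst hj
        right
        cases b
        · simp [hs _ _ _ _ h0]
        · simp [hs _ _ _ _ h1]
      · simp only [Nat.unpair_pair, if_neg hj]
        exact ih

theorem totCol_of {j : ℕ} {f : ℕ → ℕ} (hs : ∀ m k x v, ev k j (seg K m) x = some v → v = f x)
    (hc : ∀ x, ∃ m0, ∀ m ≥ m0, ∃ k0, ∀ k ≥ k0, ev k j (seg K m) x = some (f x))
    (hsub : ∀ σ : List Bool, qv (f (encode (σ ++ [false]))).unpair + qv (f (encode (σ ++ [true]))).unpair ≤
      2 * qv (f (encode σ)).unpair)
    (h0 : qv (f (encode ([] : List Bool))).unpair ≤ 1) : TotCol j := by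
  have key : ∀ n, ∃ s, n ≤ (str (st s) j).length := by
    intro n
    induction n with
    | zero => exact ⟨0, Nat.zero_le _⟩
    | succ n ih =>
      obtain ⟨s, hs'⟩ := ih
      set σ := str (st s) j with hσ
      obtain ⟨m0, hm0⟩ := hc (encode (σ ++ [false]))
      obtain ⟨m1, hm1⟩ := hc (encode (σ ++ [true]))
      obtain ⟨k0, hk0⟩ := hm0 (max m0 m1) (le_max_left _ _)
      obtain ⟨k1, hk1⟩ := hm1 (max m0 m1) (le_max_right _ _)
      set k := max s (max k0 k1) with hk
      set s' := Nat.pair j (Nat.pair (max m0 m1) k) with hs''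
      have e1 : s'.unpair.1 = j := by simp [hs'']
      have e2 : s'.unpair.2.unpair.1 = max m0 m1 := by simp [hs'']
      have e3 : s'.unpair.2.unpair.2 = k := by simp [hs'']
      have hle : s ≤ s' := by
        calc s ≤ k := le_max_left _ _
          _ ≤ Nat.pair (max m0 m1) k := Nat.right_le_pair _ _
          _ ≤ s' := Nat.right_le_pair _ _
      have hpre := str_mono hle j
      by_cases heq : str (st s') j = σ
      · have hk0' := hk0 k (le_trans (le_max_left _ _) (le_max_right _ _))
        have hk1' := hk1 k (le_trans (le_max_right _ _) (le_max_right _ _))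
        refine ⟨s'+1, ?_⟩
        have hg := st_grow s' (f (encode (σ ++ [false]))) (f (encode (σ ++ [true])))
          (by rw [e1, e2, e3, heq]; exact hk0') (by rw [e1, e2, e3, heq]; exact hk1') (by
            rw [e1, le2_iff]
            have hsσ := hsub σ
            rcases vl_sound hs s' with ⟨h1, h2⟩ | h2
            · rw [h2]
              have : σ = [] := by rw [← heq, h1]
              rw [this] at hsσ ⊢
              have : qv (1, 0) = 1 := by simp [qv]
              linarith
            · rw [h2, heq]; exact hsσ)
        rw [e1, heq] at hg
        omega
      · refine ⟨s', ?_⟩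
        rw [← hσ] at hpre
        have h1 := hpre.length_le
        by_contra hcon
        exact heq (hpre.eq_of_length (by omega)).symm
  intro n
  obtain ⟨s, hs⟩ := key (n+1)
  exact ⟨s, by omega⟩

theorem j0_total : TotCol j0 := by
  refine totCol_of (f := fun _ => Nat.pair 1 0) j0_sound j0_conv ?_ ?_
  · intro σ; simp [qv]; norm_num
  · simp [qv]

theorem exact_len {j : ℕ} (hj : TotCol j) (n : ℕ) : ∃ s, (str (st s) j).length = n := by
  have hex : ∃ s, n ≤ (str (st s) j).length := by
    obtain ⟨s, hs⟩ := hj n; exact ⟨s, by omega⟩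
  refine ⟨Nat.find hex, ?_⟩
  have h1 := Nat.find_spec hex
  rcases hf : Nat.find hex with _ | m
  · rw [hf] at h1
    have : (str (st 0) j).length = 0 := rfl
    omega
  · have h2 := Nat.find_min hex (m := m) (by omega)
    have h3 := str_len_succ m j
    rw [hf] at h1
    omega

theorem col_bound {j : ℕ} {f : ℕ → ℕ} (hs : ∀ m k x v, ev k j (seg K m) x = some v → v = f x)
    (h0 : qv (f (encode ([] : List Bool))).unpair ≤ 1) (hj : TotCol j) (n : ℕ) :
    qv (f (encode (seg (ColSet j) n))).unpair ≤ 2 ^ (j+2) := by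
  obtain ⟨s, hs'⟩ := exact_len hj n
  have h1 := str_seg s j
  rw [hs'] at h1
  rw [← h1]
  rcases vl_sound hs s with ⟨h2, h3⟩ | h2
  · rw [h2]
    have : (1:ℚ) ≤ 2 ^ (j+2) := one_le_pow₀ (by norm_num)
    linarith
  · rw [← h2]; exact vl_bound s j


theorem pr_pow3 {α : Type} [Primcodable α] {f : α → ℕ} (hf : Primrec f) : Primrec (fun a => 3 ^ f a) := by
  have h : Primrec (fun n : ℕ => 3 ^ n) := by
    refine (Primrec.nat_rec₁ (f := fun _ (i : ℕ) => 3 * i) 1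
      (Primrec.nat_mul.comp (Primrec.const 3) Primrec.snd)).of_eq ?_
    intro n
    induction n with
    | zero => rfl
    | succ n ih => simp only [ih]; ring
  exact h.comp hf

noncomputable def zc (σ : List Bool) : ℕ := (σ.filter (fun b => decide (b = false))).length

theorem zc_app (σ : List Bool) (b : Bool) : zc (σ ++ [b]) = zc σ + if b = false then 1 else 0 := by
  cases b <;> simp [zc, List.filter_append]

theorem zc_pr : Primrec zc := by
  have h := Primrec.list_length.comp (pr_filter (p := fun (_ : List Bool) (b : Bool) => b = false) Primrec.id
    (pr_eqc Primrec.snd false))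
  refine h.of_eq (fun σ => ?_)
  simp only [zc, id]
  congr 1
  exact List.filter_congr (fun b _ => decide_eq_decide.2 Iff.rfl)

/-- code of the modified martingale; `p = (σ, v)`, `v` the value of the oracle at `σ` -/
noncomputable def gco (N : ℕ) (p : List Bool × ℕ) : ℕ :=
  Nat.pair ((p.2-1).unpair.1 / 2 * 2 ^ p.1.length + 3 ^ zc p.1 * ((p.2-1).unpair.2 * N))
    ((p.2-1).unpair.2 * N * 2 ^ p.1.length * 2 - 1)

theorem gco_pr (N : ℕ) : Primrec (gco N) := by
  have hl : Primrec (fun p : List Bool × ℕ => 2 ^ p.1.length) := pr_pow2 (Primrec.list_length.comp Primrec.fst)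
  have hz : Primrec (fun p : List Bool × ℕ => 3 ^ zc p.1) := pr_pow3 (zc_pr.comp Primrec.fst)
  have hv : Primrec (fun p : List Bool × ℕ => p.2 - 1) := Primrec.nat_sub.comp Primrec.snd (Primrec.const 1)
  have ha : Primrec (fun p : List Bool × ℕ => (p.2-1).unpair.1 / 2) := Primrec.nat_div.comp (pr_un1 hv) (Primrec.const 2)
  have hd : Primrec (fun p : List Bool × ℕ => (p.2-1).unpair.2 * N) := pr_mul (pr_un2 hv) (Primrec.const N)
  exact Primrec₂.natPair.comp (pr_add (pr_mul ha hl) (pr_mul hz hd))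
    (Primrec.nat_sub.comp (pr_mul (pr_mul hd hl) (Primrec.const 2)) (Primrec.const 1))

noncomputable def gf (M : List Bool → ℚ) (N : ℕ) (e : ℕ) : ℕ :=
  gco N ((decode (α := List Bool) e).getD [], fnOracle M e)

theorem gf_CI {M : List Bool → ℚ} (hM : FRed M K) (N : ℕ) : CI K (gf M N) := by
  have h1 : CI K (fnOracle M) := CI.of_RT hM
  have h2 : Primrec (fun e : ℕ => (decode (α := List Bool) e).getD []) :=
    Primrec.option_getD.comp Primrec.decode (Primrec.const [])
  have h3 : CI K (fun e => ((decode (α := List Bool) e).getD [], fnOracle M e)) :=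
    CI.pair (CI.of_primrec h2) h1
  have h4 := CI.comp (CI.of_primrec (A := K) (gco_pr N)) h3
  exact h4

theorem gf_val {M : List Bool → ℚ} (hM : ∀ σ, 0 ≤ M σ) {N : ℕ} (hN : 0 < N) (σ : List Bool) :
    qv (gf M N (encode σ)).unpair = (M σ / N + 3 ^ zc σ / 2 ^ σ.length) / 2 := by
  have e1 : fnOracle M (encode σ) = Nat.pair (encode (M σ).num) (M σ).den + 1 := by
    simp only [fnOracle, encodek, Option.map_some, encode_some]; rfl
  have h0 : 0 ≤ (M σ).num := Rat.num_nonneg.2 (hM σ)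
  obtain ⟨a, ha⟩ := Int.eq_ofNat_of_zero_le h0
  have e2 : encode (M σ).num = 2 * a := by rw [ha]; rfl
  have e3 : M σ = a / (M σ).den := by
    conv_lhs => rw [← Rat.num_div_den (M σ)]
    rw [ha]; push_cast; rfl
  have hd : 0 < (M σ).den := (M σ).den_pos
  rw [gf, encodek, Option.getD_some, e1, e2, gco]
  simp only [Nat.add_sub_cancel, Nat.unpair_pair, qv]
  have h1 : 0 < (M σ).den * N * 2 ^ σ.length * 2 := by positivity
  have h2 : ((((M σ).den * N * 2 ^ σ.length * 2 - 1 : ℕ) : ℚ) + 1) = (M σ).den * N * 2 ^ σ.length * 2 := by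
    rw [Nat.cast_sub h1]; push_cast; ring
  rw [h2, Nat.mul_div_cancel_left a (by norm_num : 0 < 2)]
  have hd' : ((M σ).den : ℚ) ≠ 0 := by positivity
  have hN' : (N : ℚ) ≠ 0 := by positivity
  have e4 : M σ / N = a / (M σ).den / N := by rw [← e3]
  rw [e4]
  clear e4 e3
  generalize ((M σ).den : ℕ) = d at *
  push_cast
  field_simp

theorem zc_seg {A : Set ℕ} {b : ℕ} (hA : ∀ x ∈ A, x < b) (m : ℕ) : m ≤ zc (seg A (b+m)) := by
  induction m with
  | zero => exact Nat.zero_le _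
  | succ m ih =>
    rw [← Nat.add_assoc, seg_succ, zc_app]
    have : b + m ∉ A := fun h => by have := hA _ h; omega
    simp [this]
    exact ih

theorem part_a {M : List Bool → ℚ} (hM : IsMartingale M) (hr : FRed M K) :
    ∃ j, j ≠ j0 ∧ TotCol j ∧ (ColSet j).Infinite ∧ ¬ Succeeds M (ColSet j) := by
  obtain ⟨h0, h1⟩ := hM
  obtain ⟨N, hN⟩ := exists_nat_gt (M [])
  have hNpos : 0 < N := by
    have := h0 []
    have : (0:ℚ) < N := lt_of_le_of_lt this hN
    exact_mod_cast this
  have hNq : (0:ℚ) < N := by exact_mod_cast hNpos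
  have hval := gf_val h0 hNpos
  obtain ⟨j, hs, hc⟩ := ex_index (gf_CI hr N)
  have hnil : qv (gf M N (encode ([] : List Bool))).unpair < 1 := by
    rw [hval]
    have : M [] / N < 1 := by rw [div_lt_one hNq]; exact hN
    simp [zc]
    linarith
  have htot : TotCol j := by
    refine totCol_of hs hc ?_ hnil.le
    intro σ
    rw [hval, hval, hval, zc_app, zc_app]
    have := h1 σ
    have e : M (σ ++ [true]) = 2 * M σ - M (σ ++ [false]) := by linarith
    rw [e]
    simp [pow_succ]
    apply le_of_eq
    field_simp
    ring
  have hb := col_bound hs hnil.le htot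
  refine ⟨j, ?_, htot, ?_, ?_⟩
  · rintro rfl
    obtain ⟨m0, hm⟩ := hc (encode ([] : List Bool))
    obtain ⟨k0, hk⟩ := hm m0 le_rfl
    have := j0_sound _ _ _ _ (hk k0 le_rfl)
    rw [this] at hnil
    simp [qv] at hnil
  · intro hfin
    obtain ⟨b, hbb⟩ : ∃ b, ∀ x ∈ ColSet j, x < b := by
      obtain ⟨b, hb⟩ := hfin.bddAbove
      exact ⟨b+1, fun x hx => Nat.lt_succ_of_le (hb hx)⟩
    obtain ⟨m, hm⟩ := pow_unbounded_of_one_lt (2 * 2 ^ (j+2) * 2 ^ b : ℚ) (by norm_num : (1:ℚ) < 3/2)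
    have h2 := hb (b+m)
    rw [hval, seg_length] at h2
    have h3 : (3:ℚ) ^ m ≤ 3 ^ zc (seg (ColSet j) (b+m)) := pow_le_pow_right₀ (by norm_num) (zc_seg hbb m)
    have h4 : 0 ≤ M (seg (ColSet j) (b+m)) / N := div_nonneg (h0 _) hNq.le
    have h5 : (3:ℚ) ^ m / 2 ^ (b+m) ≤ 2 * 2 ^ (j+2) := by
      refine le_trans (div_le_div_of_nonneg_right h3 (by positivity)) ?_
      linarith
    rw [div_le_iff₀ (by positivity), pow_add 2 b m, ← mul_assoc] at h5
    rw [div_pow, lt_div_iff₀ (by positivity)] at hm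
    linarith
  · intro hsucc
    obtain ⟨n, hn⟩ := hsucc (N * (2 * 2 ^ (j+2)))
    have h2 := hb n
    rw [hval] at h2
    have h3 : (0:ℚ) ≤ 3 ^ zc (seg (ColSet j) n) / 2 ^ (seg (ColSet j) n).length := by positivity
    have h4 : M (seg (ColSet j) n) / N ≤ 2 * 2 ^ (j+2) := by linarith
    rw [div_le_iff₀ hNq] at h4
    linarith


abbrev Wit := List Bool × ℕ × ℕ × ℕ

def okD (n : ℕ) (h : Hist) (q : ℕ) : Prop :=
  n ≤ q.unpair.1 ∨ q.unpair.1 = j0 ∨ (str h q.unpair.1)[q.unpair.2]? = some true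

def newok (n : ℕ) (σ τ : List Bool) (h : Hist) : Prop :=
  τ.take σ.length = σ ∧ ∀ q ∈ List.range τ.length, q < σ.length ∨ ¬ τ[q]? = some true ∨ okD n h q

def goal (n : ℕ) (σ τ : List Bool) (h : Hist) (x u : ℕ) : Prop :=
  (n.unpair.1 = 0 ∧ (str h j0)[x]? = some true ∧ ev u n.unpair.2.unpair.1 τ x = some 1) ∨
  (n.unpair.1 = 1 ∧ (str h j0)[x]? = some false ∧ ev u n.unpair.2.unpair.1 τ x = some 1) ∨
  (2 ≤ n.unpair.1 ∧ τ[Nat.pair n.unpair.2.unpair.1 x]? = some true ∧ σ.length ≤ Nat.pair n.unpair.2.unpair.1 x)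

def Exn (n : ℕ) (σ τ : List Bool) (h : Hist) (x u : ℕ) : Prop :=
  newok n σ τ h ∧ goal n σ τ h x u

theorem okD_pr : PrimrecPred (fun p : ℕ × Hist × ℕ => okD p.1 p.2.1 p.2.2) := by
  have hq : Primrec (fun p : ℕ × Hist × ℕ => p.2.2) := Primrec.snd.comp Primrec.snd
  have h1 : Primrec (fun p : ℕ × Hist × ℕ => (p.2.1, p.2.2.unpair.1)) :=
    Primrec.pair (Primrec.fst.comp Primrec.snd) (pr_un1 hq)
  have h2 := str_pr.comp h1
  exact (pr_le Primrec.fst (pr_un1 hq)).or ((pr_eqc (pr_un1 hq) j0).or (pr_eqc (pr_get h2 (pr_un2 hq)) _))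

abbrev EA := (ℕ × List Bool) × (List Bool × Hist × ℕ × ℕ)

theorem Exn_pr : PrimrecPred (fun p : EA => Exn p.1.1 p.1.2 p.2.1 p.2.2.1 p.2.2.2.1 p.2.2.2.2) := by
  have hn : Primrec (fun p : EA => p.1.1) := Primrec.fst.comp Primrec.fst
  have hσ : Primrec (fun p : EA => p.1.2) := Primrec.snd.comp Primrec.fst
  have hτ : Primrec (fun p : EA => p.2.1) := Primrec.fst.comp Primrec.snd
  have hh : Primrec (fun p : EA => p.2.2.1) := Primrec.fst.comp (Primrec.snd.comp Primrec.snd)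
  have hx : Primrec (fun p : EA => p.2.2.2.1) := Primrec.fst.comp (Primrec.snd.comp (Primrec.snd.comp Primrec.snd))
  have hu : Primrec (fun p : EA => p.2.2.2.2) := Primrec.snd.comp (Primrec.snd.comp (Primrec.snd.comp Primrec.snd))
  have hk : Primrec (fun p : EA => p.1.1.unpair.1) := pr_un1 hn
  have hc : Primrec (fun p : EA => p.1.1.unpair.2.unpair.1) := pr_un1 (pr_un2 hn)
  have hsl : Primrec (fun p : EA => p.1.2.length) := Primrec.list_length.comp hσ
  have hs0 : Primrec (fun p : EA => (p.2.2.1, j0)) := Primrec.pair hh (Primrec.const j0)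
  have hs := str_pr.comp hs0
  have he0 : Primrec (fun p : EA => (p.2.2.2.2, p.1.1.unpair.2.unpair.1, p.2.1, p.2.2.2.1)) :=
    Primrec.pair hu (Primrec.pair hc (Primrec.pair hτ hx))
  have he := ev_primrec.comp he0
  have hpc : Primrec (fun p : EA => Nat.pair p.1.1.unpair.2.unpair.1 p.2.2.2.1) := Primrec₂.natPair.comp hc hx
  have hnew : PrimrecPred (fun p : EA => newok p.1.1 p.1.2 p.2.1 p.2.2.1) := by
    refine (pr_eq (Primrec.list_take.comp hsl hτ) hσ).and (pr_forall (Primrec.list_range.comp (Primrec.list_length.comp hτ)) ?_)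
    have h0 : Primrec (fun q : EA × ℕ => (q.1.1.1, q.1.2.2.1, q.2)) :=
      Primrec.pair (hn.comp Primrec.fst) (Primrec.pair (hh.comp Primrec.fst) Primrec.snd)
    exact (pr_lt Primrec.snd (hsl.comp Primrec.fst)).or
      ((pr_eqc (pr_get (hτ.comp Primrec.fst) Primrec.snd) _).not.or (okD_pr.comp h0))
  have hgoal : PrimrecPred (fun p : EA => goal p.1.1 p.1.2 p.2.1 p.2.2.1 p.2.2.2.1 p.2.2.2.2) := by
    have g1 := (pr_eqc hk 0).and ((pr_eqc (pr_get hs hx) (some true)).and (pr_eqc he (some 1)))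
    have g2 := (pr_eqc hk 1).and ((pr_eqc (pr_get hs hx) (some false)).and (pr_eqc he (some 1)))
    have g3 := (pr_le (Primrec.const 2) hk).and ((pr_eqc (pr_get hτ hpc) (some true)).and (pr_le hsl hpc))
    exact g1.or (g2.or g3)
  exact hnew.and hgoal

noncomputable def RR (p : (ℕ × List Bool) × ℕ) : Bool :=
  (decode (α := Wit) p.2).elim false (fun w => decide (Exn p.1.1 p.1.2 w.1 (st w.2.1) w.2.2.1 w.2.2.2))

theorem RR_CI : CI K RR := by
  have h1 : CI K (fun q : ((ℕ × List Bool) × ℕ) × Wit => st q.2.2.1) :=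
    CI.comp st_CI (CI.of_primrec (Primrec.fst.comp (Primrec.snd.comp Primrec.snd)))
  have h2 : Primrec (fun q : ((ℕ × List Bool) × ℕ) × Wit => q.2.2.2) :=
    Primrec.snd.comp (Primrec.snd.comp Primrec.snd)
  have h3 : Primrec (fun q : ((ℕ × List Bool) × ℕ) × Wit => q.2.1) := Primrec.fst.comp Primrec.snd
  have h4 : Primrec (fun q : ((ℕ × List Bool) × ℕ) × Wit => q.1.1) := Primrec.fst.comp Primrec.fst
  have h5 : CI K (fun q : ((ℕ × List Bool) × ℕ) × Wit => (q.1.1, q.2.1, st q.2.2.1, q.2.2.2)) :=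
    CI.pair (CI.of_primrec h4) (CI.pair (CI.of_primrec h3) (CI.pair h1 (CI.of_primrec h2)))
  have h6 := CI.comp (CI.of_primrec (A := K) Exn_pr.decide) h5
  have h7 : Primrec (fun p : (ℕ × List Bool) × ℕ => decode (α := Wit) p.2) := Primrec.decode.comp Primrec.snd
  have h8 := CI_opt h6 (CI.of_primrec (A := K) h7) (CI.of_primrec (A := K) (Primrec.const false))
  refine h8.of_eq (fun p => ?_)
  unfold RR
  rcases decode (α := Wit) p.2 with _ | w
  · rfl
  · exact decide_eq_decide.2 Iff.rfl

noncomputable def nxt (p : ℕ × List Bool) : List Bool :=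
  (mu RR p).elim p.2 (fun y => ((decode (α := Wit) y).map (·.1)).getD p.2) ++ [false]

theorem nxt_CI : CI (jump K) nxt := by
  have h1 := CI_mu RR_CI
  have h2 : Primrec (fun q : ((ℕ × List Bool) × ℕ) => ((decode (α := Wit) q.2).map (·.1)).getD q.1.2) :=
    Primrec.option_getD.comp (Primrec.option_map (Primrec.decode.comp Primrec.snd) (Primrec.fst.comp Primrec.snd))
      (Primrec.snd.comp Primrec.fst)
  have h3 := CI_opt (CI.of_primrec (A := jump K) h2) h1 (CI.of_primrec (A := jump K) Primrec.snd)
  have h4 : Primrec (fun l : List Bool => l ++ [false]) := Primrec.list_append.comp Primrec.id (Primrec.const [false])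
  have h5 := CI.comp (CI.of_primrec (A := jump K) h4) h3
  exact h5

noncomputable def sg (n : ℕ) : List Bool := n.rec [] (fun n σ => nxt (n, σ))

theorem sg_succ (n : ℕ) : sg (n+1) = nxt (n, sg n) := rfl

theorem sg_CI : CI (jump K) sg := by
  have h : CI (jump K) (fun q : Unit × ℕ × List Bool => nxt q.2) :=
    CI.comp nxt_CI (CI.of_primrec Primrec.snd)
  have h1 := CI.nat_rec (f := fun _ : Unit => ([] : List Bool)) (g := fun q : Unit × ℕ × List Bool => nxt q.2)
    (CI.of_primrec (Primrec.const [])) h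
  have h2 : Primrec (fun n : ℕ => (((), n) : Unit × ℕ)) := Primrec.pair (Primrec.const _) Primrec.id
  have h3 := CI.comp h1 (CI.of_primrec (A := jump K) h2)
  exact h3

theorem sg_cases (n : ℕ) : ((∀ τ s x u, ¬ Exn n (sg n) τ (st s) x u) ∧ sg (n+1) = sg n ++ [false]) ∨
    ∃ τ s x u, Exn n (sg n) τ (st s) x u ∧ sg (n+1) = τ ++ [false] := by
  rw [sg_succ, nxt]
  rcases hm : mu RR (n, sg n) with _ | y
  · left
    refine ⟨?_, rfl⟩
    intro τ s x u hE
    have := mu_none hm (encode ((τ, s, x, u) : Wit))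
    simp [RR, hE] at this
  · right
    have := mu_some hm
    unfold RR at this
    rcases hd : decode (α := Wit) y with _ | w
    · simp [hd] at this
    · simp only [hd, Option.elim_some, decide_eq_true_eq] at this
      exact ⟨w.1, w.2.1, w.2.2.1, w.2.2.2, this, by rw [Option.elim_some, hd]; rfl⟩

theorem sg_pre_succ (n : ℕ) : sg n <+: sg (n+1) := by
  rcases sg_cases n with ⟨-, h⟩ | ⟨τ, s, x, u, h, h'⟩
  · rw [h]; exact List.prefix_append _ _
  · rw [h']
    have h1 := h.1.1
    have : sg n <+: τ := by rw [← h1]; exact List.take_prefix _ _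
    exact this.trans (List.prefix_append _ _)

theorem sg_len_succ (n : ℕ) : (sg n).length < (sg (n+1)).length := by
  rcases sg_cases n with ⟨-, h⟩ | ⟨τ, s, x, u, h, h'⟩
  · rw [h]; simp
  · rw [h']
    have h1 := h.1.1
    have : sg n <+: τ := by rw [← h1]; exact List.take_prefix _ _
    have := this.length_le
    simp; omega

theorem sg_pre {n m : ℕ} (h : n ≤ m) : sg n <+: sg m := by
  induction m, h using Nat.le_induction with
  | base => exact List.prefix_rfl
  | succ n _ ih => exact ih.trans (sg_pre_succ n)

theorem sg_len (n : ℕ) : n ≤ (sg n).length := by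
  induction n with
  | zero => exact Nat.zero_le _
  | succ n ih => have := sg_len_succ n; omega

def DD : Set ℕ := {q | ∃ n, (sg n)[q]? = some true}

theorem DD_iff {n q : ℕ} (h : q < (sg n).length) : q ∈ DD ↔ (sg n)[q]? = some true := by
  constructor
  · rintro ⟨m, hm⟩
    have h1 := pre_get (sg_pre (le_max_left m n)) hm
    have h2 : (sg n)[q]? = some (sg n)[q] := List.getElem?_eq_getElem h
    have h3 := pre_get (sg_pre (le_max_right m n)) h2
    rw [h2, ← h3, h1]
  · intro h; exact ⟨n, h⟩

theorem seg_DD (n : ℕ) : seg DD (sg n).length = sg n := by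
  apply List.ext_getElem?
  intro i
  by_cases hi : i < (sg n).length
  · rw [seg_get _ _ _ hi]
    have h1 : (sg n)[i]? = some (sg n)[i] := List.getElem?_eq_getElem hi
    have h2 := DD_iff hi
    rw [h1] at h2 ⊢
    cases hb : (sg n)[i] <;> rw [hb] at h2 <;> simp [h2]
  · rw [List.getElem?_eq_none (by rw [seg_length]; omega), List.getElem?_eq_none (by omega)]

theorem DD_CI : CI (jump K) (fun q => decide (q ∈ DD)) := by
  have h1 : Primrec (fun q : ℕ => q + 1) := Primrec.succ
  have h2 := CI.comp sg_CI (CI.of_primrec (A := jump K) h1)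
  have h3 := CI.pair (CI.of_primrec (A := jump K) Primrec.id) h2
  have h5 : Primrec (fun q : ℕ × List Bool => decide (q.2[q.1]? = some true)) :=
    (pr_eqc (pr_get Primrec.snd Primrec.fst) _).decide
  have h6 := CI.comp (CI.of_primrec (A := jump K) h5) h3
  refine h6.of_eq (fun q => ?_)
  have := sg_len (q+1)
  have h7 := DD_iff (n := q+1) (q := q) (by omega)
  simp only [id]
  exact decide_eq_decide.2 h7.symm

theorem DD_step {n q : ℕ} (hq : (sg n).length ≤ q) (h : (sg (n+1))[q]? = some true) :
    n ≤ q.unpair.1 ∨ q.unpair.1 = j0 ∨ Pos q true := by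
  have hlt : ∀ l : List Bool, (l ++ [false])[q]? = some true → q < l.length ∧ l[q]? = some true := by
    intro l hl
    by_cases h1 : q < l.length
    · rw [List.getElem?_append_left h1] at hl; exact ⟨h1, hl⟩
    · rw [List.getElem?_append_right (by omega)] at hl
      rcases hh : q - l.length with _ | k <;> rw [hh] at hl <;> simp at hl
  rcases sg_cases n with ⟨-, h'⟩ | ⟨τ, s, x, u, hE, h'⟩
  · rw [h'] at h
    have := hlt _ h
    omega
  · rw [h'] at h
    obtain ⟨h1, h2⟩ := hlt _ h
    rcases hE.1.2 q (List.mem_range.2 h1) with h3 | h3 | h3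
    · omega
    · exact absurd h2 h3
    · rcases h3 with h3 | h3 | h3
      · exact Or.inl h3
      · exact Or.inr (Or.inl h3)
      · exact Or.inr (Or.inr ⟨s, h3⟩)

theorem DD_pos {n q : ℕ} (hq : (sg n).length ≤ q) (h : q ∈ DD) :
    n ≤ q.unpair.1 ∨ q.unpair.1 = j0 ∨ Pos q true := by
  have hex : ∃ m, q < (sg m).length := ⟨q+1, by have := sg_len (q+1); omega⟩
  have h1 := Nat.find_spec hex
  rcases hf : Nat.find hex with _ | m
  · rw [hf] at h1
    have : (sg 0).length = 0 := rfl
    omega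
  · have h2 := Nat.find_min hex (m := m) (by omega)
    rw [hf] at h1
    have hnm : n ≤ m := by
      by_contra hc
      have := (sg_pre (show m+1 ≤ n by omega)).length_le
      omega
    rcases DD_step (by omega) ((DD_iff h1).1 h) with h3 | h3
    · exact Or.inl (by omega)
    · exact Or.inr h3

theorem D_part_a {j : ℕ} (hj : j ≠ j0) (hinf : (ColSet j).Infinite) :
    ∃ S : Set ℕ, S.Infinite ∧ S ⊆ ColSet j ∧ TRed S DD := by
  set L := (sg (j+1)).length with hL
  refine ⟨{x | Nat.pair j x ∈ DD ∧ L ≤ Nat.pair j x}, ?_, ?_, ?_⟩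
  · rw [Set.infinite_iff_exists_gt]
    intro b
    set i := Nat.pair j (b+1) + j + 1 with hi
    set n := Nat.pair 2 (Nat.pair j i) with hn
    have hin : i ≤ n := (Nat.right_le_pair _ _).trans (Nat.right_le_pair _ _)
    have e1 : n.unpair.1 = 2 := by simp [hn]
    have e2 : n.unpair.2.unpair.1 = j := by simp [hn]
    have hln := sg_len n
    rcases sg_cases n with ⟨h, -⟩ | ⟨τ, s, x, u, hE, h'⟩
    · exfalso
      obtain ⟨x, hx, hxl⟩ := hinf.exists_gt (sg n).length
      obtain ⟨s, hs⟩ := hx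
      have hp : (sg n).length < Nat.pair j x := lt_of_lt_of_le hxl (Nat.right_le_pair _ _)
      set τ := sg n ++ (List.replicate (Nat.pair j x - (sg n).length) false ++ [true]) with hτ
      have hget : ∀ q, (sg n).length ≤ q → τ[q]? = some true → q = Nat.pair j x := by
        intro q hq hg
        rw [hτ, List.getElem?_append_right hq] at hg
        by_cases h1 : q - (sg n).length < Nat.pair j x - (sg n).length
        · rw [List.getElem?_append_left (by simpa using h1)] at hg
          rw [List.getElem?_replicate_of_lt h1] at hg
          simp at hg
        · rw [List.getElem?_append_right (by simpa using h1)] at hg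
          simp only [List.length_replicate] at hg
          rcases hh : q - (sg n).length - (Nat.pair j x - (sg n).length) with _ | k
          · omega
          · rw [hh] at hg; simp at hg
      refine h τ s x 0 ⟨⟨by simp [hτ], ?_⟩, Or.inr (Or.inr ⟨by omega, ?_, ?_⟩)⟩
      · intro q _
        by_cases h1 : q < (sg n).length
        · exact Or.inl h1
        · by_cases h2 : τ[q]? = some true
          · right; right; right; right
            rw [hget q (by omega) h2]; exact hs
          · exact Or.inr (Or.inl h2)
      · rw [e2, hτ, List.getElem?_append_right (by omega), List.getElem?_append_right (by simp)]
        simp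
      · rw [e2]; omega
    · rcases hE.2 with h | h | h
      · omega
      · omega
      · obtain ⟨-, h1, h2⟩ := h
        rw [e2] at h1 h2
        have hb : Nat.pair j (b+1) < Nat.pair j x := by omega
        refine ⟨x, ⟨⟨n+1, ?_⟩, ?_⟩, ?_⟩
        · rw [h']; exact pre_get (List.prefix_append _ _) h1
        · have := (sg_pre (show j+1 ≤ n by omega)).length_le
          omega
        · by_contra hc
          have : x < b + 1 := by omega
          have := Nat.pair_lt_pair_right j this
          omega
  · rintro x ⟨h1, h2⟩
    rcases DD_pos h2 h1 with h | h | h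
    · simp at h
    · simp at h; exact absurd h hj
    · exact h
  · apply TRed.of_CI
    have h1 : Primrec (fun x : ℕ => Nat.pair j x) := Primrec₂.natPair.comp (Primrec.const j) Primrec.id
    have h2 := CI.comp (CI.oracle (A := DD)) (CI.of_primrec (A := DD) h1)
    have h3 : Primrec (fun x : ℕ => decide (L ≤ Nat.pair j x)) := (pr_le (Primrec.const L) h1).decide
    have h4 := CI.cond h2 (CI.of_primrec (A := DD) h3) (CI.of_primrec (A := DD) (Primrec.const false))
    refine h4.of_eq (fun x => ?_)
    by_cases hx : Nat.pair j x ∈ DD <;> simp [hx]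


theorem list_bd (h : Hist) : ∃ t, ∀ e ∈ h, e.1 < t := by
  induction h with
  | nil => exact ⟨0, by simp⟩
  | cons a h ih =>
    obtain ⟨t, ht⟩ := ih
    refine ⟨max t (a.1+1), ?_⟩
    intro e he
    rcases List.mem_cons.1 he with rfl | he
    · exact lt_of_lt_of_le (Nat.lt_succ_self _) (le_max_right _ _)
    · exact lt_of_lt_of_le (ht e he) (le_max_left _ _)

theorem dec_stage (t : ℕ) : ∃ s, ∀ q < t, ∀ b, Pos q b → (str (st s) q.unpair.1)[q.unpair.2]? = some b := by
  induction t with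
  | zero => exact ⟨0, by simp⟩
  | succ t ih =>
    obtain ⟨s, hs⟩ := ih
    by_cases h : ∃ b, Pos t b
    · obtain ⟨b, s', hs'⟩ := h
      refine ⟨max s s', ?_⟩
      intro q hq b' hb'
      rcases Nat.lt_succ_iff_lt_or_eq.1 hq with hq | rfl
      · exact st_get_mono (le_max_left _ _) (hs q hq b' hb')
      · obtain ⟨s'', hs''⟩ := hb'
        have := st_get_unique hs' hs''
        subst this
        exact st_get_mono (le_max_right _ _) hs'
    · push Not at h
      refine ⟨s, ?_⟩
      intro q hq b' hb'
      rcases Nat.lt_succ_iff_lt_or_eq.1 hq with hq | rfl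
      · exact hs q hq b' hb'
      · exact absurd hb' (h b')

theorem pos_ex {j : ℕ} (hj : TotCol j) (x : ℕ) : ∃ b, Pos (Nat.pair j x) b := by
  obtain ⟨s, hs⟩ := hj x
  obtain ⟨b, hb⟩ : ∃ b, (str (st s) j)[x]? = some b := ⟨_, List.getElem?_eq_getElem hs⟩
  exact ⟨b, s, by simpa using hb⟩

theorem bool_ne_not {a b : Bool} (h : ¬ a = b) : a = !b := by
  revert h; cases a <;> cases b <;> simp

theorem Qfin (n : ℕ) : {q : ℕ | q.unpair.1 < n ∧ ¬ TotCol q.unpair.1 ∧ Pos q true}.Finite := by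
  have h : ∀ e, ∃ N, ¬ TotCol e → ∀ s, (str (st s) e).length ≤ N := by
    intro e
    by_cases he : TotCol e
    · exact ⟨0, fun h => absurd he h⟩
    · unfold TotCol at he
      push Not at he
      obtain ⟨N, hN⟩ := he
      exact ⟨N, fun _ => hN⟩
  choose N hN using h
  refine Set.Finite.subset ((Finset.range n).biUnion (fun e => (Finset.range (N e)).image (Nat.pair e))).finite_toSet ?_
  rintro q ⟨h1, h2, s, hs⟩
  have h3 := hN _ h2 s
  have h4 : q.unpair.2 < (str (st s) q.unpair.1).length := by
    by_contra hc
    rw [List.getElem?_eq_none (by omega)] at hs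
    simp at hs
  simp only [Finset.coe_biUnion, Set.mem_iUnion, Finset.coe_image, Set.mem_image]
  exact ⟨q.unpair.1, by simpa using h1, q.unpair.2, by simp; omega, Nat.pair_unpair q⟩

theorem seg_of_pre {D : Set ℕ} {τ : List Bool} {m : ℕ} (h : τ <+: seg D m) : τ = seg D τ.length := by
  apply List.ext_getElem?
  intro i
  by_cases hi : i < τ.length
  · have h1 : τ[i]? = some τ[i] := List.getElem?_eq_getElem hi
    have h2 := pre_get h h1
    have h3 := h.length_le
    rw [seg_length] at h3
    rw [seg_get _ _ _ (by omega)] at h2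
    rw [seg_get _ _ _ hi, h1, ← h2]
  · rw [List.getElem?_eq_none (by omega), List.getElem?_eq_none (by rw [seg_length]; omega)]

theorem seg_pre (D : Set ℕ) {m n : ℕ} (h : m ≤ n) : seg D m <+: seg D n := by
  induction n, h using Nat.le_induction with
  | base => exact List.prefix_rfl
  | succ n _ ih => rw [seg_succ]; exact ih.trans (List.prefix_append _ _)

set_option maxHeartbeats 1000000 in
theorem part_b (S : Set ℕ) (hS : S.Infinite) (pol : Bool) (hpol : ∀ x ∈ S, (x ∈ ColSet j0 ↔ pol = true))
    (hred : TRed S DD) : False := by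
  obtain ⟨c, hsound, hconv⟩ := ex_index (TRed.toCI hred)
  set n := Nat.pair (if pol = true then 1 else 0) (Nat.pair c 0) with hn
  have e1 : n.unpair.1 = if pol = true then 1 else 0 := by simp [hn]
  have e2 : n.unpair.2.unpair.1 = c := by simp [hn]
  clear_value n
  clear hn
  rcases sg_cases n with ⟨hno, -⟩ | ⟨τ, s, x, u, hE, h'⟩
  swap
  · -- an extension was found
    have hτ : τ = seg DD τ.length := by
      apply seg_of_pre (m := (sg (n+1)).length)
      rw [seg_DD, h']
      exact List.prefix_append _ _
    have hg : (str (st s) j0)[x]? = some (!pol) ∧ ev u c τ x = some 1 := by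
      have := hE.2
      unfold goal at this
      rw [e1, e2] at this
      cases pol <;> simpa using this
    obtain ⟨g1, g2⟩ := hg
    rw [hτ] at g2
    have h3 := hsound _ _ _ _ g2
    have hx : x ∈ S := by
      by_contra hc
      simp [chi, hc] at h3
    have h4 := hpol x hx
    have h5 := st_get_true g1
    rw [h4] at h5
    cases pol <;> simp at h5
  -- no extension
  have hno' : ∀ τ s x u, newok n (sg n) τ (st s) → (str (st s) j0)[x]? = some (!pol) → ev u c τ x = some 1 → False := by
    intro τ s x u h1 h2 h3
    refine hno τ s x u ⟨h1, ?_⟩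
    unfold goal
    rw [e1, e2]
    cases pol
    · first
        | exact Or.inl ⟨by simp, h2, h3⟩
        | exact Or.inr ⟨by simp, h2, h3⟩
        | exact Or.inr (Or.inl ⟨by simp, h2, h3⟩)
    · first
        | exact Or.inl ⟨by simp, h2, h3⟩
        | exact Or.inr ⟨by simp, h2, h3⟩
        | exact Or.inr (Or.inl ⟨by simp, h2, h3⟩)
  set B := (List.range n).filter (fun e => decide (¬ TotCol e)) with hB
  have hBm : ∀ e, e ∈ B ↔ e < n ∧ ¬ TotCol e := by intro e; simp [hB]
  set Q := (Qfin n).toFinset.toList with hQ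
  have hQm : ∀ q, q ∈ Q ↔ q.unpair.1 < n ∧ ¬ TotCol q.unpair.1 ∧ Pos q true := by
    intro q; rw [hQ, Finset.mem_toList, Set.Finite.mem_toFinset]; rfl
  clear_value B Q
  set rq : Rq := (sg n, n, c, pol, B, Q) with hrq
  obtain ⟨r, hdr⟩ : ∃ r, decode r = some rq := ⟨encode rq, encodek rq⟩
  have hW : ∀ x ∈ S, ∃ w m u, decode w = some (seg DD m, x, u) ∧ (sg n).length ≤ m ∧ m ≤ w ∧
      Nat.pair j0 x < w ∧ ev u c (seg DD m) x = some 1 := by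
    intro x hx
    obtain ⟨m0, hm0⟩ := hconv x
    obtain ⟨k0, hk0⟩ := hm0 (max m0 (sg n).length) (le_max_left _ _)
    set m := max m0 (sg n).length with hm
    set u := max k0 (m + Nat.pair j0 x + 1) with hu
    have hu1 : u ≤ encode ((seg DD m, x, u) : List Bool × ℕ × ℕ) := by
      rw [encode_prod_val]
      refine le_trans ?_ (Nat.right_le_pair _ _)
      rw [encode_prod_val]
      exact Nat.right_le_pair _ _
    have hu2 : m + Nat.pair j0 x + 1 ≤ u := le_max_right _ _
    refine ⟨encode ((seg DD m, x, u) : List Bool × ℕ × ℕ), m, u, encodek _, le_max_right _ _, by omega, by omega, ?_⟩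
    rw [hk0 u (le_max_left _ _)]
    simp [chi, hx]
  obtain ⟨X, hXS, hXc⟩ := hS.exists_subset_card_eq (r+2)
  choose! wf mf uf hw1 hw2 hw3 hw4 hw5 using hW
  obtain ⟨t1, ht1⟩ : ∃ t1, ∀ x ∈ X, wf x < t1 :=
    ⟨X.sup wf + 1, fun x hx => Nat.lt_succ_of_le (Finset.le_sup (f := wf) hx)⟩
  obtain ⟨s, hs⟩ := dec_stage t1
  obtain ⟨t2, ht2⟩ := list_bd (st s)
  obtain ⟨z, hzl, hzc, hzE⟩ := no_all_EE s (max (max t1 (r+1)) t2)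
    (fun e he => lt_of_lt_of_le (ht2 e he) (le_max_right _ _))
  have hlt1 : t1 ≤ z.length := by rw [hzl]; exact (le_max_left _ _).trans (le_max_left _ _)
  have hlr : r < z.length := by
    rw [hzl]
    exact lt_of_lt_of_le (Nat.lt_succ_self r) ((le_max_right _ _).trans (le_max_left _ _))
  -- positions
  have hz : ∀ q < t1, ∀ b, Pos q b → z[q]? = some b := by
    intro q hq b hb
    have h1 := hs q hq b hb
    rw [Wf_mem (st_Wf s)] at h1
    obtain ⟨v, hv⟩ := h1
    rw [Nat.pair_unpair] at hv
    exact hzc _ hv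
  have hok1 : ∀ q < t1, okpos rq z q → okD n (st s) q := by
    intro q hq ho
    rcases ho with h | h | h | h
    · exact Or.inl h
    · exact Or.inr (Or.inl h)
    · right; right
      exact hs q hq true ((hQm q).1 h).2.2
    · by_cases hqn : n ≤ q.unpair.1
      · exact Or.inl hqn
      right; right
      have hnB : q.unpair.1 ∉ B := h.1
      have htot : TotCol q.unpair.1 := by
        by_contra hc
        exact hnB ((hBm _).2 ⟨by omega, hc⟩)
      obtain ⟨b, hb⟩ := pos_ex htot q.unpair.2
      rw [Nat.pair_unpair] at hb
      have h1 := hz q hq b hb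
      rw [h.2] at h1
      have : true = b := Option.some.inj h1
      subst this
      exact hs q hq true hb
  have hok2 : ∀ q < t1, (n ≤ q.unpair.1 ∨ q.unpair.1 = j0 ∨ Pos q true) → okpos rq z q := by
    intro q hq ho
    rcases ho with h | h | h
    · exact Or.inl h
    · exact Or.inr (Or.inl h)
    · by_cases hqn : n ≤ q.unpair.1
      · exact Or.inl hqn
      by_cases htot : TotCol q.unpair.1
      · right; right; right
        refine ⟨?_, hz q hq true h⟩
        intro hB'
        exact ((hBm _).1 hB').2 htot
      · right; right; left
        exact (hQm q).2 ⟨by omega, htot, h⟩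
  -- soundness
  have hsnd : ∀ w < t1, ∀ p, valid rq z w = some p → z[p]? = some pol := by
    intro w hw p hp
    obtain ⟨hpw, -, y, -, ⟨v1, v2, v3, v4, v5⟩, rfl⟩ := valid_some hp
    obtain ⟨b, hb⟩ := pos_ex j0_total y.2.1
    have hb1 := hs _ (by omega) b hb
    simp only [Nat.unpair_pair] at hb1
    have hbp : b = pol := by
      by_contra hc
      have hb2 : b = !pol := bool_ne_not hc
      subst hb2
      refine hno' y.1 s y.2.1 y.2.2 ⟨v1, ?_⟩ hb1 v4
      intro q hq
      have hq' := List.mem_range.1 hq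
      rcases v5 q hq with h | h | h
      · exact Or.inl h
      · exact Or.inr (Or.inl h)
      · exact Or.inr (Or.inr (hok1 q (by omega) h))
    subst hbp
    exact hz _ (by omega) b hb
  -- completeness
  have hcmp : ∀ x ∈ X, valid rq z (wf x) = some (Nat.pair j0 x) := by
    intro x hx
    have hxS := hXS hx
    have hwt := ht1 x hx
    unfold valid
    rw [hw1 x hxS, Option.bind_some, if_pos]
    have hm3 := hw3 x hxS
    have hm2 := hw2 x hxS
    refine ⟨?_, ?_, hw4 x hxS, hw5 x hxS, ?_⟩
    · change (seg DD (mf x)).take (sg n).length = sg n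
      have h1 := seg_pre DD hm2
      rw [seg_DD] at h1
      exact (List.prefix_iff_eq_take.1 h1).symm
    · simpa [seg_length] using hm3
    · intro q hq
      have hq' := List.mem_range.1 hq
      simp only [seg_length] at hq'
      by_cases h1 : q < (sg n).length
      · exact Or.inl h1
      right
      by_cases h2 : q ∈ DD
      · right
        exact hok2 q (by omega) (DD_pos (by omega) h2)
      · left
        change ¬ (seg DD (mf x))[q]? = some true
        rw [seg_get _ _ _ hq']
        simp [h2]
  obtain ⟨p1, p2, p3, p4⟩ := Lr_props rq (r+2) z t1
  have hlen : (Lr rq (r+2) z t1).length = r+2 := by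
    by_contra hc
    have h1 := p4 (by omega)
    have h2 : X.image (Nat.pair j0) ⊆ (Lr rq (r+2) z t1).toFinset := by
      intro p hp
      obtain ⟨x, hx, rfl⟩ := Finset.mem_image.1 hp
      exact List.mem_toFinset.2 (h1 _ (ht1 x hx) _ (hcmp x hx))
    have h3 := Finset.card_le_card h2
    rw [Finset.card_image_of_injective, hXc] at h3
    · have := List.toFinset_card_le (Lr rq (r+2) z t1)
      omega
    · intro a b hab
      have := congrArg (fun y => y.unpair.2) hab
      simpa using this
  have hstab := Lr_stable hlen hlt1
  apply hzE
  refine ⟨r, List.mem_range.2 hlr, rq, hdr, ?_, ?_⟩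
  · rw [hstab]; exact hlen
  · intro q hq
    rw [hstab] at hq
    obtain ⟨w, hw, hv⟩ := p3 q hq
    exact hsnd w hw q hv

/-- there is `D ≤_T ∅''` such that (a) the class of `Δ⁰₂` sets with an
infinite subset or cosubset computable in `D` is not `Δ⁰₂` null, and (b) some `Δ⁰₂` set
has no infinite subset or cosubset computable in `D`: a `Δ⁰₃` almost s-Ramsey degree
that is not s-Ramsey. -/
theorem stmt4 :
    ∃ D : Set ℕ, TRed D (jump K) ∧
      (∀ M : List Bool → ℚ, IsMartingale M → FRed M K →
        ∃ A : Set ℕ, A.Infinite ∧ TRed A K ∧ ¬ Succeeds M A ∧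
          ∃ S : Set ℕ, S.Infinite ∧ S ⊆ A ∧ TRed S D) ∧
      (∃ C : Set ℕ, TRed C K ∧
        ∀ S : Set ℕ, S.Infinite → (S ⊆ C ∨ S ⊆ Cᶜ) → ¬ TRed S D) := by
  refine ⟨DD, TRed.of_CI DD_CI, ?_, ColSet j0, TRed.of_CI (col_CI j0_total), ?_⟩
  · intro M hM hr
    obtain ⟨j, h1, h2, h3, h4⟩ := part_a hM hr
    exact ⟨ColSet j, h3, TRed.of_CI (col_CI h2), h4, D_part_a h1 h3⟩
  · intro S hS hsub hred
    rcases hsub with h | h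
    · exact part_b S hS true (fun x hx => by simpa using h hx) hred
    · exact part_b S hS false (fun x hx => by simpa using h hx) hred
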